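/- arXiv:2409.00428 — 6 statements merged into one kernel-verified Lean document; each statement's English description precedes it below -/
import Mathlib

section
/- For every real x ≥ 2 and integer q ≥ 1, one has the exact identity Σ_{a=1}^{q} |E_x(q,a)|² = (1/q) Σ_{a=1}^{q} |Δ(a/q)|². -/
open scoped BigOperators

/-- `e(t) = exp(2πit)` -/
noncomputable def e (t : ℝ) : ℂ := Complex.exp (2 * Real.pi * Complex.I * t)

/-- the 3-fold divisor function `d₃(n) = Σ_{abc=n} 1` -/
def d3 (n : ℕ) : ℕ :=
  ((Finset.Icc 1 n ×ˢ Finset.Icc 1 n ×ˢ Finset.Icc 1 n).filter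
    (fun p : ℕ × ℕ × ℕ => p.1 * p.2.1 * p.2.2 = n)).card

section

open Finset

lemma injOn_natCast_zmod_Icc {q : ℕ} : Set.InjOn (fun b : ℕ => (b : ZMod q)) (Icc 1 q) := by
  intro b hb c hc h
  simp only [coe_Icc, Set.mem_Icc] at hb hc
  simp only [ZMod.natCast_eq_natCast_iff'] at h
  rcases hb.2.eq_or_lt with h1 | h1 <;> rcases hc.2.eq_or_lt with h2 | h2
  · omega
  · rw [h1, Nat.mod_self, Nat.mod_eq_of_lt h2] at h; omega
  · rw [h2, Nat.mod_self, Nat.mod_eq_of_lt h1] at h; omega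
  · rwa [Nat.mod_eq_of_lt h1, Nat.mod_eq_of_lt h2] at h

lemma sum_Icc_natCast_zmod {q : ℕ} [NeZero q] {A : Type*} [AddCommMonoid A] (f : ZMod q → A) :
    ∑ b ∈ Icc 1 q, f (b : ZMod q) = ∑ z, f z := by
  have hq := NeZero.pos q
  refine sum_bij (fun b _ => (b : ZMod q)) (by simp)
    (fun b hb c hc h => injOn_natCast_zmod_Icc hb hc h) ?_ (by simp)
  · intro z _
    by_cases hz : z = 0
    · exact ⟨q, by simp [mem_Icc]; omega, by simp [hz]⟩
    · refine ⟨z.val, ?_, by simp⟩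
      rw [mem_Icc]
      exact ⟨Nat.pos_of_ne_zero ((ZMod.val_ne_zero z).2 hz), (ZMod.val_lt z).le⟩

lemma zmod_val_natCast_gcd (q n : ℕ) : Nat.gcd (n : ZMod q).val q = Nat.gcd n q := by
  rw [ZMod.val_natCast, Nat.gcd_comm n q, Nat.gcd_rec q n]

lemma zmod_gcd_val_unit_mul {q : ℕ} [NeZero q] {u : ZMod q} (hu : IsUnit u) (z : ZMod q) :
    Nat.gcd (u * z).val q = Nat.gcd z.val q := by
  obtain ⟨u, rfl⟩ := hu
  have h : (u : ZMod q) * z = (((u : ZMod q).val * z.val : ℕ) : ZMod q) := by simp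
  rw [h, zmod_val_natCast_gcd]
  exact Nat.Coprime.gcd_mul_left_cancel _ (ZMod.val_coe_unit_coprime u)

lemma zmod_exists_unit_mul_of_gcd_eq {q : ℕ} [NeZero q] {z w : ZMod q}
    (h : Nat.gcd z.val q = Nat.gcd w.val q) : ∃ u : (ZMod q)ˣ, w = u * z := by
  obtain ⟨d, hd, u, hu, rfl⟩ := z.eq_unit_mul_divisor
  obtain ⟨d', hd', u', hu', rfl⟩ := w.eq_unit_mul_divisor
  rw [zmod_gcd_val_unit_mul hu, zmod_gcd_val_unit_mul hu', zmod_val_natCast_gcd,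
    zmod_val_natCast_gcd, Nat.gcd_eq_left hd, Nat.gcd_eq_left hd'] at h
  obtain ⟨u, rfl⟩ := hu
  obtain ⟨u', rfl⟩ := hu'
  refine ⟨u' * u⁻¹, ?_⟩
  subst h
  simp [← mul_assoc]

lemma zmod_card_gcd_val_eq {q : ℕ} [NeZero q] (w : ZMod q) :
    #{z : ZMod q | Nat.gcd z.val q = Nat.gcd w.val q} = Nat.totient (q / Nat.gcd w.val q) := by
  rw [Nat.totient_div_of_dvd (Nat.gcd_dvd_right _ _)]
  refine card_bij (fun z _ => z.val) ?_ (fun _ _ _ _ h => ZMod.val_injective q h) ?_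
  · intro z hz
    simp only [mem_filter, mem_univ, true_and] at hz
    simp [ZMod.val_lt, Nat.gcd_comm q, hz]
  · intro n hn
    simp only [mem_filter, mem_range] at hn
    refine ⟨(n : ZMod q), ?_, ZMod.val_cast_of_lt hn.1⟩
    simp [ZMod.val_cast_of_lt hn.1, ← hn.2, Nat.gcd_comm q]

/-- A function on `ZMod q` minus its averages over the orbits of the unit group. -/
noncomputable def subOrbitAvg {q : ℕ} [NeZero q] (f : ZMod q → ℂ) (z : ZMod q) : ℂ :=
  f z - ∑ b, if Nat.gcd z.val q = Nat.gcd b.val q then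
    f b / Nat.totient (q / Nat.gcd b.val q) else 0

lemma zmod_card_mul_gcd_eq {q : ℕ} [NeZero q] (c b : ZMod q) :
    #{y : ZMod q | Nat.gcd (c * y).val q = Nat.gcd b.val q} =
      Nat.totient (q / Nat.gcd b.val q) * #{y : ZMod q | c * y = b} := by
  rw [← zmod_card_gcd_val_eq b, card_eq_sum_card_fiberwise (f := fun y => c * y)
    (t := {z : ZMod q | Nat.gcd z.val q = Nat.gcd b.val q}) (by intro y hy; simpa using hy)]
  apply sum_const_nat
  intro z hz
  simp only [mem_filter, mem_univ, true_and] at hz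
  obtain ⟨u, hu⟩ := zmod_exists_unit_mul_of_gcd_eq hz
  have : filter (fun y => c * y = z) {y : ZMod q | Nat.gcd (c * y).val q = Nat.gcd b.val q} =
      ({y : ZMod q | c * y = z} : Finset (ZMod q)) := by
    ext y
    simp only [mem_filter, mem_univ, true_and, and_iff_right_iff_imp]
    rintro rfl
    exact hz
  rw [this]
  refine card_bij (fun y _ => u * y) ?_ ?_ ?_
  · intro y hy
    simp only [mem_filter, mem_univ, true_and] at hy ⊢
    rw [hu, ← hy]; ring
  · intro y _ y' _ h
    exact u.isUnit.mul_left_cancel h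
  · intro y hy
    simp only [mem_filter, mem_univ, true_and] at hy
    refine ⟨(u⁻¹ : (ZMod q)ˣ) * y, ?_, by simp⟩
    simp only [mem_filter, mem_univ, true_and]
    rw [mul_left_comm, hy, hu]; simp

lemma sum_subOrbitAvg_mul {q : ℕ} [NeZero q] (f : ZMod q → ℂ) (c : ZMod q) :
    ∑ y, subOrbitAvg f (c * y) = 0 := by
  have h1 : ∑ y, f (c * y) = ∑ b, f b * #{y : ZMod q | c * y = b} := by
    rw [← sum_fiberwise univ (fun y => c * y)]
    refine sum_congr rfl fun b _ => ?_
    rw [sum_congr rfl (g := fun _ => f b) (by intro y hy; simp at hy; rw [hy])]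
    simp [mul_comm]
  simp only [subOrbitAvg, sum_sub_distrib]
  rw [h1, sum_comm, sub_eq_zero]
  refine sum_congr rfl fun b _ => ?_
  rw [← sum_filter, sum_const, zmod_card_mul_gcd_eq]
  have : (Nat.totient (q / Nat.gcd b.val q) : ℂ) ≠ 0 := by
    rw [Nat.cast_ne_zero, Nat.totient_eq_zero.ne]
    exact (Nat.div_pos (Nat.gcd_le_right _ (NeZero.pos q)) (Nat.gcd_pos_of_pos_right _ (NeZero.pos q))).ne'
  simp only [nsmul_eq_mul]
  push_cast
  field_simp

lemma d3_eq_sum_divisorsAntidiagonal (n : ℕ) :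
    d3 n = ∑ p ∈ n.divisorsAntidiagonal, ∑ _r ∈ p.1.divisorsAntidiagonal, 1 := by
  rw [sum_sigma', ← card_eq_sum_ones, d3]
  refine card_bij (fun t _ => ⟨(t.1 * t.2.1, t.2.2), (t.1, t.2.1)⟩) ?_ ?_ ?_
  · rintro ⟨a, b, c⟩ h
    simp only [mem_filter, mem_product, mem_Icc] at h
    obtain ⟨⟨⟨ha, -⟩, ⟨hb, -⟩, hc, -⟩, rfl⟩ := h
    simp only [mem_sigma, Nat.mem_divisorsAntidiagonal, true_and]
    constructor <;> positivity
  · rintro ⟨a, b, c⟩ - ⟨a', b', c'⟩ - h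
    simp at h ⊢
    tauto
  · rintro ⟨⟨m, c⟩, ⟨a, b⟩⟩ h
    simp only [mem_sigma, Nat.mem_divisorsAntidiagonal] at h
    obtain ⟨⟨h1, h2⟩, rfl, h3⟩ := h
    refine ⟨(a, b, c), ?_, rfl⟩
    have hc : c ≠ 0 := by rintro rfl; simp at h1; omega
    have ha : a ≠ 0 := by rintro rfl; simp at h3
    have hb : b ≠ 0 := by rintro rfl; simp at h3
    simp only [mem_filter, mem_product, mem_Icc]
    refine ⟨⟨⟨by omega, ?_⟩, ⟨by omega, ?_⟩, by omega, ?_⟩, h1⟩ <;>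
      refine Nat.le_of_dvd (by omega) ?_ <;> rw [← h1]
    · exact Dvd.intro _ (mul_assoc a b c).symm
    · exact Dvd.intro (a * c) (by ring)
    · exact Dvd.intro_left _ rfl

/-- The indicator function of a residue class. -/
noncomputable def residueIndicator {q : ℕ} (b z : ZMod q) : ℂ := if z = b then 1 else 0

lemma d3_mul_eq_sum_convolution {q : ℕ} [NeZero q] (Φ : ZMod q → ℂ) (n : ℕ) :
    (d3 n : ℂ) * Φ n = ∑ b₁ : ZMod q, ∑ b₂ : ZMod q, ∑ b₃ : ZMod q, Φ (b₁ * b₂ * b₃) *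
      LSeries.convolution (LSeries.convolution (fun n : ℕ => residueIndicator b₁ n)
        (fun n : ℕ => residueIndicator b₂ n)) (fun n : ℕ => residueIndicator b₃ n) n := by
  rw [d3_eq_sum_divisorsAntidiagonal]
  simp only [LSeries.convolution_def, mul_sum, sum_mul, Nat.cast_sum]
  simp_rw [sum_comm (s := univ) (t := n.divisorsAntidiagonal)]
  refine sum_congr rfl fun p hp => ?_
  simp_rw [sum_comm (s := univ) (t := p.1.divisorsAntidiagonal)]
  refine sum_congr rfl fun r hr => ?_
  rw [Nat.mem_divisorsAntidiagonal] at hp hr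
  simp [residueIndicator, ← hp.1, ← hr.1]

lemma hasSum_d3_mul_div_cpow {q : ℕ} [NeZero q] (Φ : ZMod q → ℂ) {s : ℂ} (hs : 1 < s.re) :
    HasSum (fun n : ℕ => (d3 n : ℂ) * Φ n / (n : ℂ) ^ s)
      (∑ b₁ : ZMod q, ∑ b₂ : ZMod q, ∑ b₃ : ZMod q, Φ (b₁ * b₂ * b₃) *
        (ZMod.LFunction (residueIndicator b₁) s * ZMod.LFunction (residueIndicator b₂) s *
          ZMod.LFunction (residueIndicator b₃) s)) := by
  have hL (b : ZMod q) : LSeriesHasSum (fun n : ℕ => residueIndicator b n) s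
      (ZMod.LFunction (residueIndicator b) s) := by
    rw [ZMod.LFunction_eq_LSeries _ hs]
    exact (ZMod.LSeriesSummable_of_one_lt_re _ hs).LSeriesHasSum
  have key := hasSum_sum (s := univ) fun b₁ _ => hasSum_sum (s := univ) fun b₂ _ =>
    hasSum_sum (s := univ) fun b₃ _ =>
      (((hL b₁).convolution (hL b₂)).convolution (hL b₃)).mul_left (Φ (b₁ * b₂ * b₃))
  refine key.congr_fun ?_
  intro n
  rw [d3_mul_eq_sum_convolution]
  rcases eq_or_ne n 0 with rfl | hn
  · simp
  · simp only [LSeries.term_of_ne_zero hn, sum_div, mul_div_assoc]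

lemma LFunction_residueIndicator {q : ℕ} [NeZero q] (b : ZMod q) (s : ℂ) :
    ZMod.LFunction (residueIndicator b) s =
      ZMod.LFunction (fun _ : ZMod q => (1 / q : ℂ)) s +
        ZMod.LFunction (fun z => residueIndicator b z - 1 / q) s := by
  simp only [ZMod.LFunction, ← mul_add, ← sum_add_distrib, ← add_mul, add_sub_cancel]

lemma differentiable_LFunction_residueIndicator_sub {q : ℕ} [NeZero q] (b : ZMod q) :
    Differentiable ℂ (ZMod.LFunction (fun z => residueIndicator b z - 1 / (q : ℂ))) := by
  apply ZMod.differentiable_LFunction_of_sum_zero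
  have : (q : ℂ) ≠ 0 := NeZero.ne _
  simp [residueIndicator, this]

lemma sum_triple_product_add {q : ℕ} [NeZero q] (Φ : ZMod q → ℂ)
    (hΦ : ∀ c, ∑ y, Φ (c * y) = 0) (α : ℂ) (h : ZMod q → ℂ) :
    ∑ b₁, ∑ b₂, ∑ b₃, Φ (b₁ * b₂ * b₃) * ((α + h b₁) * (α + h b₂) * (α + h b₃)) =
      ∑ b₁, ∑ b₂, ∑ b₃, Φ (b₁ * b₂ * b₃) * (h b₁ * h b₂ * h b₃) := by
  have h3 (u v : ZMod q → ℂ) : ∑ b₁, ∑ b₂, ∑ b₃, Φ (b₁ * b₂ * b₃) * (u b₁ * v b₂ * α) = 0 := by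
    refine sum_eq_zero fun b₁ _ => sum_eq_zero fun b₂ _ => ?_
    rw [← sum_mul, hΦ, zero_mul]
  have h2 (u w : ZMod q → ℂ) : ∑ b₁, ∑ b₂, ∑ b₃, Φ (b₁ * b₂ * b₃) * (u b₁ * α * w b₃) = 0 := by
    refine sum_eq_zero fun b₁ _ => ?_
    rw [sum_comm]
    refine sum_eq_zero fun b₃ _ => ?_
    rw [← sum_mul]
    simp_rw [mul_right_comm b₁ _ b₃]
    rw [hΦ, zero_mul]
  have h1 (v w : ZMod q → ℂ) : ∑ b₁, ∑ b₂, ∑ b₃, Φ (b₁ * b₂ * b₃) * (α * v b₂ * w b₃) = 0 := by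
    rw [sum_comm]
    refine sum_eq_zero fun b₂ _ => ?_
    rw [sum_comm]
    refine sum_eq_zero fun b₃ _ => ?_
    rw [← sum_mul]
    simp_rw [fun b₁ : ZMod q => show b₁ * b₂ * b₃ = (b₂ * b₃) * b₁ by ring]
    rw [hΦ, zero_mul]
  have e1 := h3 (fun b => α + h b) (fun b => α + h b)
  have e2 := h2 (fun b => α + h b) h
  have e3 := h1 h h
  have e4 := congrArg₂ (· + ·) (congrArg₂ (· + ·) e1 e2) e3
  simp only [← sum_add_distrib, add_zero] at e4
  rw [← sub_eq_zero, ← e4]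
  simp only [← sum_sub_distrib]
  refine sum_congr rfl fun b₁ _ => sum_congr rfl fun b₂ _ => sum_congr rfl fun b₃ _ => ?_
  ring

lemma frequently_one_lt_re : ∃ᶠ s in nhdsWithin (1 : ℂ) {(1 : ℂ)}ᶜ, 1 < s.re := by
  have ht : Filter.Tendsto (fun t : ℝ => (t : ℂ)) (nhdsWithin 1 (Set.Ioi 1))
      (nhdsWithin (1 : ℂ) {(1 : ℂ)}ᶜ) := by
    refine tendsto_nhdsWithin_iff.2 ⟨?_, ?_⟩
    · have : Filter.Tendsto (fun t : ℝ => (t : ℂ)) (nhds 1) (nhds ((1 : ℝ) : ℂ)) :=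
        Complex.continuous_ofReal.tendsto 1
      rw [Complex.ofReal_one] at this
      exact this.mono_left nhdsWithin_le_nhds
    · filter_upwards [self_mem_nhdsWithin] with t ht
      simpa using (ne_of_gt ht)
  refine ht.frequently (Filter.Eventually.frequently ?_)
  filter_upwards [self_mem_nhdsWithin] with t ht
  simpa using ht

lemma iteratedDeriv_two_eq_zero_of_d3 {q : ℕ} [NeZero q] (Φ : ZMod q → ℂ)
    (hΦ : ∀ c, ∑ y, Φ (c * y) = 0) {x : ℝ} (hx : 0 < x) {G : ℂ → ℂ} (hG : AnalyticAt ℂ G 1)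
    (h : ∀ᶠ s in nhdsWithin (1 : ℂ) {(1 : ℂ)}ᶜ, 1 < s.re →
      G s = (s - 1) ^ 3 * (∑' n : ℕ, (d3 n : ℂ) * Φ n / (n : ℂ) ^ s) * (x : ℂ) ^ s / s) :
    iteratedDeriv 2 G 1 = 0 := by
  let η (b : ZMod q) : ℂ → ℂ := ZMod.LFunction (fun z => residueIndicator b z - 1 / (q : ℂ))
  let K (s : ℂ) : ℂ := (∑ b₁, ∑ b₂, ∑ b₃, Φ (b₁ * b₂ * b₃) * (η b₁ s * η b₂ s * η b₃ s)) *
    (x : ℂ) ^ s / s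
  have hη (b : ZMod q) : AnalyticAt ℂ (η b) 1 :=
    (differentiable_LFunction_residueIndicator_sub b).analyticAt 1
  have hx' : (x : ℂ) ∈ Complex.slitPlane := Complex.ofReal_mem_slitPlane.2 hx
  have hK : AnalyticAt ℂ K 1 := by
    refine AnalyticAt.div (AnalyticAt.mul ?_ (analyticAt_const.cpow analyticAt_id hx'))
      analyticAt_id one_ne_zero
    refine Finset.analyticAt_fun_sum _ fun b₁ _ => Finset.analyticAt_fun_sum _ fun b₂ _ =>
      Finset.analyticAt_fun_sum _ fun b₃ _ => ?_
    exact analyticAt_const.mul (((hη b₁).mul (hη b₂)).mul (hη b₃))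
  have hfr : ∃ᶠ s in nhdsWithin (1 : ℂ) {(1 : ℂ)}ᶜ, G s = (s - 1) ^ 3 * K s := by
    refine (frequently_one_lt_re.and_eventually h).mono ?_
    rintro s ⟨hs, hs'⟩
    rw [hs' hs, (hasSum_d3_mul_div_cpow Φ hs).tsum_eq]
    simp_rw [LFunction_residueIndicator _ s]
    rw [sum_triple_product_add Φ hΦ]
    simp only [K, η]
    ring
  have hev := (hG.frequently_eq_iff_eventually_eq (by fun_prop)).1 hfr
  have ho : ((3 : ℕ) : ℕ∞) ≤ analyticOrderAt G 1 :=
    (natCast_le_analyticOrderAt hG).2 ⟨K, hK, hev⟩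
  exact (natCast_le_analyticOrderAt_iff_iteratedDeriv_eq_zero hG).1 ho 2 (by norm_num)

lemma e_eq_stdAddChar {q : ℕ} [NeZero q] (n a : ℕ) :
    e ((n : ℝ) * a / q) = ZMod.stdAddChar ((a : ZMod q) * (n : ZMod q)) := by
  have := ZMod.stdAddChar_coe (N := q) ((a * n : ℕ) : ℤ)
  push_cast at this
  rw [this, e]
  congr 1
  push_cast
  ring

lemma parseval_stdAddChar {q : ℕ} [NeZero q] (f : ℕ → ℂ) :
    ∑ a ∈ Icc 1 q, ‖∑ b ∈ Icc 1 q, f b * ZMod.stdAddChar ((a : ZMod q) * (b : ZMod q))‖ ^ 2 =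
      (q : ℝ) * ∑ b ∈ Icc 1 q, ‖f b‖ ^ 2 := by
  have hinj := injOn_natCast_zmod_Icc (q := q)
  have horth (b c : ℕ) (hb : b ∈ Icc 1 q) (hc : c ∈ Icc 1 q) :
      ∑ a ∈ Icc 1 q, (ZMod.stdAddChar ((a : ZMod q) * (b : ZMod q)) : ℂ) *
        (starRingEnd ℂ) (ZMod.stdAddChar ((a : ZMod q) * (c : ZMod q))) =
      if b = c then (q : ℂ) else 0 := by
    rw [sum_Icc_natCast_zmod (fun a : ZMod q => (ZMod.stdAddChar (a * (b : ZMod q)) : ℂ) *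
        (starRingEnd ℂ) (ZMod.stdAddChar (a * (c : ZMod q))))]
    simp_rw [← AddChar.map_neg_eq_conj, ← AddChar.map_add_eq_mul, ← mul_neg, ← mul_add]
    rw [AddChar.sum_mulShift _ (ZMod.isPrimitive_stdAddChar q), ← sub_eq_add_neg]
    simp [sub_eq_zero, hinj.eq_iff hb hc, ZMod.card]
  apply Complex.ofReal_injective
  push_cast
  simp_rw [← Complex.mul_conj', map_sum, sum_mul_sum, map_mul]
  rw [sum_comm, mul_sum]
  refine sum_congr rfl fun b hb => ?_
  rw [sum_comm]
  have : ∀ c ∈ Icc 1 q, ∑ a ∈ Icc 1 q, f b * (ZMod.stdAddChar ((a : ZMod q) * (b : ZMod q)) : ℂ) *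
      ((starRingEnd ℂ) (f c) *
        (starRingEnd ℂ) (ZMod.stdAddChar ((a : ZMod q) * (c : ZMod q)))) =
      f b * (starRingEnd ℂ) (f c) * if b = c then (q : ℂ) else 0 := by
    intro c hc
    rw [← horth b c hb hc, mul_sum]
    exact sum_congr rfl fun a _ => by ring
  rw [sum_congr rfl this]
  simp only [mul_ite, mul_zero, sum_ite_eq, hb, if_true]
  ring

lemma subOrbitAvg_natCast {q : ℕ} [NeZero q] (f : ZMod q → ℂ) (n : ℕ) :
    subOrbitAvg f n = f n - ∑ b ∈ Icc 1 q, if Nat.gcd n q = Nat.gcd q b then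
      f b / Nat.totient (q / Nat.gcd q b) else 0 := by
  have h := sum_Icc_natCast_zmod (fun b : ZMod q => if Nat.gcd n q = Nat.gcd b.val q then
    f b / (Nat.totient (q / Nat.gcd b.val q) : ℂ) else 0)
  rw [subOrbitAvg, zmod_val_natCast_gcd, ← h]
  simp only [zmod_val_natCast_gcd]
  simp only [Nat.gcd_comm _ q]

lemma sum_mul_stdAddChar_eq_sum_residue_classes {q : ℕ} [NeZero q] (S : Finset ℕ) (w : ℕ → ℂ)
    (f : ZMod q → ℂ) :
    ∑ n ∈ S, w n * f n = ∑ b ∈ Icc 1 q, (∑ n ∈ S with n % q = b % q, w n) * f b := by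
  simp_rw [← ZMod.natCast_eq_natCast_iff']
  rw [sum_Icc_natCast_zmod (fun b : ZMod q => (∑ n ∈ S with ((n : ℕ) : ZMod q) = b, w n) * f b),
    ← sum_fiberwise S (fun n => (n : ZMod q))]
  refine sum_congr rfl fun b _ => ?_
  rw [sum_mul]
  refine sum_congr rfl fun n hn => ?_
  rw [(mem_filter.1 hn).2]

end

/-- For every real `x ≥ 2` and integer `q ≥ 1` one has the exact identity
`Σ_{a=1}^{q} |E_x(q,a)|² = (1/q) Σ_{a=1}^{q} |Δ(a/q)|²`.
Here `E a` is the meromorphic continuation of `E_{a/q}(s) = Σ_{n≥1} d₃(n)e(na/q)n^{-s}`,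
`R a = Res_{s=1}{E_{a/q}(s) x^s/s}`, `Δ(a/q) = Σ_{n≤x} d₃(n) e(na/q) − R a`; and `D a` is
the continuation of `Σ_{gcd(n,q)=gcd(q,a)} d₃(n)n^{-s}`,
`M a = (x/φ(q/gcd(q,a))) Res_{s=1}{D_a(s)x^{s-1}/s}`, and
`E_x(q,a) = Σ_{n ≤ x, n ≡ a (q)} d₃(n) − M a`.  The residues of the poles (of order at
most 3) are expressed through analytic functions `g` as second Taylor coefficients. -/
theorem stmt2 (x : ℝ) (hx : 2 ≤ x) (q : ℕ) (hq : 1 ≤ q)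
    (E : ℕ → ℂ → ℂ) (R : ℕ → ℂ) (D : ℕ → ℂ → ℂ) (M : ℕ → ℂ)
    (hE : ∀ a : ℕ, ∀ s : ℂ, 1 < s.re →
      HasSum (fun n : ℕ => (d3 n : ℂ) * e ((n : ℝ) * a / q) / (n : ℂ) ^ s) (E a s))
    (hR : ∀ a : ℕ, ∃ g : ℂ → ℂ, AnalyticAt ℂ g 1 ∧
      (∀ᶠ s in nhdsWithin (1 : ℂ) {(1 : ℂ)}ᶜ,
        g s = (s - 1) ^ 3 * E a s * (x : ℂ) ^ s / s) ∧
      R a = iteratedDeriv 2 g 1 / 2)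
    (hD : ∀ a : ℕ, ∀ s : ℂ, 1 < s.re →
      HasSum (fun n : ℕ =>
        if Nat.gcd n q = Nat.gcd q a then (d3 n : ℂ) / (n : ℂ) ^ s else 0) (D a s))
    (hM : ∀ a : ℕ, ∃ g : ℂ → ℂ, AnalyticAt ℂ g 1 ∧
      (∀ᶠ s in nhdsWithin (1 : ℂ) {(1 : ℂ)}ᶜ,
        g s = (s - 1) ^ 3 * D a s * (x : ℂ) ^ (s - 1) / s) ∧
      M a = (x : ℂ) / (Nat.totient (q / Nat.gcd q a) : ℂ) * (iteratedDeriv 2 g 1 / 2)) :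
    ∑ a ∈ Finset.Icc 1 q,
        ‖(∑ n ∈ (Finset.Icc 1 ⌊x⌋₊).filter (fun n => n % q = a % q), (d3 n : ℂ)) - M a‖ ^ 2
      = (1 / (q : ℝ)) * ∑ a ∈ Finset.Icc 1 q,
        ‖(∑ n ∈ Finset.Icc 1 ⌊x⌋₊, (d3 n : ℂ) * e ((n : ℝ) * a / q)) - R a‖ ^ 2 := by
  have : NeZero q := ⟨by omega⟩
  have hx0 : 0 < x := by linarith
  have hxC : (x : ℂ) ≠ 0 := by exact_mod_cast hx0.ne'
  have hRM (a : ℕ) : R a = ∑ b ∈ Finset.Icc 1 q,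
      M b * ZMod.stdAddChar ((a : ZMod q) * (b : ZMod q)) := by
    obtain ⟨g, hg, hgE, hRa⟩ := hR a
    choose k hk hkD hMk using hM
    let f : ZMod q → ℂ := fun z => ZMod.stdAddChar ((a : ZMod q) * z)
    let c (b : ℕ) : ℂ := x * (f b / (Nat.totient (q / Nat.gcd q b) : ℂ))
    have hck (b : ℕ) : AnalyticAt ℂ (fun s => c b * k b s) 1 := analyticAt_const.mul (hk b)
    have hsum : AnalyticAt ℂ (fun s => ∑ b ∈ Finset.Icc 1 q, c b * k b s) 1 :=
      Finset.analyticAt_fun_sum _ fun b _ => hck b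
    have hzero : iteratedDeriv 2 (fun s => g s - ∑ b ∈ Finset.Icc 1 q, c b * k b s) 1 = 0 := by
      refine iteratedDeriv_two_eq_zero_of_d3 (subOrbitAvg f) (sum_subOrbitAvg_mul f) hx0
        (hg.fun_sub hsum) ?_
      have hall : ∀ᶠ s in nhdsWithin (1 : ℂ) {(1 : ℂ)}ᶜ, ∀ b ∈ Finset.Icc 1 q,
          k b s = (s - 1) ^ 3 * D b s * (x : ℂ) ^ (s - 1) / s :=
        (Filter.eventually_all_finset _).2 fun b _ => hkD b
      filter_upwards [hgE, hall] with s hs hks hre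
      have hsumE : HasSum (fun n : ℕ => (d3 n : ℂ) * subOrbitAvg f n / (n : ℂ) ^ s)
          (E a s - ∑ b ∈ Finset.Icc 1 q, f b / (Nat.totient (q / Nat.gcd q b) : ℂ) * D b s) := by
        refine ((hE a s hre).sub (hasSum_sum fun b _ => (hD b s hre).mul_left
          (f b / (Nat.totient (q / Nat.gcd q b) : ℂ)))).congr_fun fun n => ?_
        rw [subOrbitAvg_natCast, e_eq_stdAddChar, mul_sub, sub_div, Finset.mul_sum,
          Finset.sum_div]
        congr 1
        refine Finset.sum_congr rfl fun b _ => ?_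
        split_ifs
        · ring
        · simp
      rw [hsumE.tsum_eq, hs, Finset.sum_congr rfl fun b hb => by rw [hks b hb], mul_sub,
        sub_mul, sub_div, Finset.mul_sum, Finset.sum_mul, Finset.sum_div]
      congr 1
      refine Finset.sum_congr rfl fun b _ => ?_
      rw [Complex.cpow_sub _ _ hxC, Complex.cpow_one]
      simp only [c]
      field_simp
    rw [iteratedDeriv_fun_sub hg.contDiffAt hsum.contDiffAt,
      iteratedDeriv_fun_sum fun b _ => (hck b).contDiffAt, sub_eq_zero] at hzero
    rw [hRa, hzero, Finset.sum_div]
    refine Finset.sum_congr rfl fun b _ => ?_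
    rw [iteratedDeriv_const_mul_field, hMk b]
    simp only [c, f]
    ring
  have hΔ (a : ℕ) : (∑ n ∈ Finset.Icc 1 ⌊x⌋₊, (d3 n : ℂ) * e ((n : ℝ) * a / q)) - R a =
      ∑ b ∈ Finset.Icc 1 q,
        ((∑ n ∈ (Finset.Icc 1 ⌊x⌋₊).filter (fun n => n % q = b % q), (d3 n : ℂ)) - M b) *
          ZMod.stdAddChar ((a : ZMod q) * (b : ZMod q)) := by
    simp_rw [e_eq_stdAddChar]
    rw [sum_mul_stdAddChar_eq_sum_residue_classes _ _
      (fun z : ZMod q => ZMod.stdAddChar ((a : ZMod q) * z)), hRM, ← Finset.sum_sub_distrib]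
    simp only [sub_mul]
  simp_rw [hΔ]
  rw [parseval_stdAddChar, ← mul_assoc, one_div_mul_cancel (by exact_mod_cast NeZero.ne q),
    one_mul]
end

section
/- Fix integers a, b, c, a′, b′, c′. Then the arithmetic function q ↦ S_{𝐚,𝐛,𝐜}(q) := Σ′_{h=1}^{q} R_{a,b,c}(h/q) · conj(R_{a′,b′,c′}(h/q)) is multiplicative: if gcd(q, q′) = 1 then S_{𝐚,𝐛,𝐜}(qq′) = S_{𝐚,𝐛,𝐜}(q) · S_{𝐚,𝐛,𝐜}(q′). -/
open scoped BigOperators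

/-- `R_{a,b,c}(h/q) = Σ_{x,y,z=1}^{q} e((ax + by + cz − hxyz)/q)` -/
noncomputable def Rabc (a b c h : ℤ) (q : ℕ) : ℂ :=
  ∑ x ∈ Finset.Icc 1 q, ∑ y ∈ Finset.Icc 1 q, ∑ z ∈ Finset.Icc 1 q,
    e (((a * x + b * y + c * z - h * x * y * z : ℤ) : ℝ) / q)

/-- `S_{𝐚,𝐛,𝐜}(q) = Σ′_{h=1}^{q} R_{a,b,c}(h/q) · conj(R_{a′,b′,c′}(h/q))` -/
noncomputable def Sabc (a b c a' b' c' : ℤ) (q : ℕ) : ℂ :=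
  ∑ h ∈ (Finset.Icc 1 q).filter (fun h => Nat.Coprime h q),
    Rabc a b c h q * starRingEnd ℂ (Rabc a' b' c' h q)

open ZMod in
/-- The additive character of `ZMod n` evaluates to `e (k / n)` at an integer `k`. -/
theorem e_div_eq_stdAddChar (n : ℕ) [NeZero n] (k : ℤ) :
    e ((k : ℝ) / n) = stdAddChar (N := n) (k : ZMod n) := by
  rw [stdAddChar_coe, e]
  congr 1
  push_cast
  ring

theorem sum_Icc_natCast_zmod_s3 {M : Type*} [AddCommMonoid M] (n : ℕ) [NeZero n] (f : ZMod n → M) :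
    ∑ x ∈ Finset.Icc 1 n, f (x : ZMod n) = ∑ x : ZMod n, f x := by
  have hn : 0 < n := NeZero.pos n
  refine Finset.sum_bij (fun x _ => (x : ZMod n)) (fun _ _ => Finset.mem_univ _) ?_ ?_
    (fun _ _ => rfl)
  · intro x hx y hy hxy
    rw [Finset.mem_Icc] at hx hy
    have h := (ZMod.natCast_eq_natCast_iff x y n).mp hxy
    rcases le_total x y with hle | hle
    · have hd := (Nat.modEq_iff_dvd' hle).mp h
      have := Nat.eq_zero_of_dvd_of_lt hd (by omega)
      omega
    · have hd := (Nat.modEq_iff_dvd' hle).mp h.symm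
      have := Nat.eq_zero_of_dvd_of_lt hd (by omega)
      omega
  · intro x _
    by_cases hx : x = 0
    · exact ⟨n, Finset.mem_Icc.mpr ⟨hn, le_rfl⟩, by simp [hx]⟩
    · refine ⟨x.val, Finset.mem_Icc.mpr ⟨?_, x.val_lt.le⟩, by simp⟩
      exact Nat.one_le_iff_ne_zero.mpr (by simpa using hx)

/-- The exponential sum `∑ e(r(ax + by + cz - uxyz)/n)` over residues `x, y, z` modulo `n`. -/
noncomputable def twistedSum (n : ℕ) [NeZero n] (a b c : ℤ) (r u : ZMod n) : ℂ :=
  ∑ x : ZMod n, ∑ y : ZMod n, ∑ z : ZMod n,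
    ZMod.stdAddChar
      (r * ((a : ZMod n) * x + (b : ZMod n) * y + (c : ZMod n) * z - u * x * y * z))

theorem Rabc_eq_twistedSum (n : ℕ) [NeZero n] (a b c h : ℤ) :
    Rabc a b c h n = twistedSum n a b c 1 h := by
  unfold Rabc twistedSum
  simp only [e_div_eq_stdAddChar, ← sum_Icc_natCast_zmod_s3]
  push_cast
  simp only [one_mul]

/-- The sum over invertible `u` of the correlations of two twisted sums. -/
noncomputable def twistedCorrelation (n : ℕ) [NeZero n] (a b c a' b' c' : ℤ) (r : ZMod n) : ℂ :=
  open scoped Classical in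
  ∑ u : ZMod n, if IsUnit u then
    twistedSum n a b c r u * starRingEnd ℂ (twistedSum n a' b' c' r u) else 0

theorem Sabc_eq_twistedCorrelation (n : ℕ) [NeZero n] (a b c a' b' c' : ℤ) :
    Sabc a b c a' b' c' n = twistedCorrelation n a b c a' b' c' 1 := by
  unfold Sabc twistedCorrelation
  rw [Finset.sum_filter, ← sum_Icc_natCast_zmod_s3]
  refine Finset.sum_congr rfl fun h _ => ?_
  simp only [ZMod.isUnit_iff_coprime, Rabc_eq_twistedSum, Int.cast_natCast]

theorem twistedSum_eq_one_twist {n : ℕ} [NeZero n] (a b c : ℤ) (r : (ZMod n)ˣ) (u : ZMod n) :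
    twistedSum n a b c r u = twistedSum n a b c 1 (↑(r⁻¹ ^ 2) * u) := by
  unfold twistedSum
  rw [← Equiv.sum_comp (Units.mulLeft r⁻¹)]
  refine Finset.sum_congr rfl fun x _ => ?_
  rw [← Equiv.sum_comp (Units.mulLeft r⁻¹)]
  refine Finset.sum_congr rfl fun y _ => ?_
  rw [← Equiv.sum_comp (Units.mulLeft r⁻¹)]
  refine Finset.sum_congr rfl fun z _ => ?_
  congr 1
  simp only [Units.mulLeft_apply, Units.val_pow_eq_pow_val]
  have h : (r : ZMod n) * ↑r⁻¹ = 1 := r.mul_inv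
  linear_combination
    ((a : ZMod n) * x + (b : ZMod n) * y + (c : ZMod n) * z - u * x * y * z * (↑r⁻¹ : ZMod n) ^ 2) * h

theorem twistedCorrelation_eq_one_twist {n : ℕ} [NeZero n] (a b c a' b' c' : ℤ) (r : (ZMod n)ˣ) :
    twistedCorrelation n a b c a' b' c' r = twistedCorrelation n a b c a' b' c' 1 := by
  unfold twistedCorrelation
  simp only [twistedSum_eq_one_twist _ _ _ r]
  conv_rhs => rw [← Equiv.sum_comp (Units.mulLeft (r⁻¹ ^ 2))]
  simp only [Units.mulLeft_apply, Units.isUnit_units_mul]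

theorem sum_mul_comp_equiv_prod {W A B R : Type*} [Fintype W] [Fintype A] [Fintype B]
    [NonUnitalNonAssocSemiring R] (E : W ≃ A × B) (f : A → R) (g : B → R) :
    ∑ w, f (E w).1 * g (E w).2 = (∑ x, f x) * ∑ y, g y := by
  rw [Equiv.sum_comp E fun p => f p.1 * g p.2, Fintype.sum_mul_sum, Fintype.sum_prod_type]

theorem exists_stdAddChar_mul (m n : ℕ) [NeZero m] [NeZero n] (h : m.Coprime n) :
    ∃ (r : (ZMod m)ˣ) (s : (ZMod n)ˣ), ∀ w : ZMod (m * n),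
      ZMod.stdAddChar w = ZMod.stdAddChar ((r : ZMod m) * (ZMod.chineseRemainder h w).1) *
        ZMod.stdAddChar ((s : ZMod n) * (ZMod.chineseRemainder h w).2) := by
  have hbez : (m : ℤ) * m.gcdA n + n * m.gcdB n = 1 := by
    rw [← Nat.gcd_eq_gcd_ab, h.gcd_eq_one, Nat.cast_one]
  have hr : ((m.gcdB n : ℤ) : ZMod m) * n = 1 := by
    have := congrArg (Int.cast : ℤ → ZMod m) hbez
    push_cast at this
    rw [ZMod.natCast_self, zero_mul, zero_add] at this
    rw [mul_comm, this]
  have hs : ((m.gcdA n : ℤ) : ZMod n) * m = 1 := by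
    have := congrArg (Int.cast : ℤ → ZMod n) hbez
    push_cast at this
    rw [ZMod.natCast_self, zero_mul, add_zero] at this
    rw [mul_comm, this]
  refine ⟨Units.mkOfMulEqOne _ _ hr, Units.mkOfMulEqOne _ _ hs, fun w => ?_⟩
  obtain ⟨k, rfl⟩ := ZMod.intCast_surjective w
  simp only [map_intCast, Prod.fst_intCast, Prod.snd_intCast, Units.val_mkOfMulEqOne,
    ← Int.cast_mul, ZMod.stdAddChar_coe, ← Complex.exp_add]
  congr 1
  have hm : (m : ℂ) ≠ 0 := NeZero.ne _
  have hn : (n : ℂ) ≠ 0 := NeZero.ne _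
  have hC : (m : ℂ) * (m.gcdA n : ℤ) + n * (m.gcdB n : ℤ) = 1 := by exact_mod_cast hbez
  push_cast
  field_simp
  linear_combination -(k : ℂ) * hC

theorem twistedSum_mul {m n : ℕ} [NeZero m] [NeZero n] (h : m.Coprime n) (a b c : ℤ)
    {r : ZMod m} {s : ZMod n}
    (hrs : ∀ w : ZMod (m * n),
      ZMod.stdAddChar w = ZMod.stdAddChar (r * (ZMod.chineseRemainder h w).1) *
        ZMod.stdAddChar (s * (ZMod.chineseRemainder h w).2)) (u : ZMod (m * n)) :
    twistedSum (m * n) a b c 1 u =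
      twistedSum m a b c r (ZMod.chineseRemainder h u).1 *
        twistedSum n a b c s (ZMod.chineseRemainder h u).2 := by
  unfold twistedSum
  let E := (ZMod.chineseRemainder h).toEquiv
  rw [← sum_mul_comp_equiv_prod E]
  refine Finset.sum_congr rfl fun x _ => ?_
  rw [← sum_mul_comp_equiv_prod E]
  refine Finset.sum_congr rfl fun y _ => ?_
  rw [← sum_mul_comp_equiv_prod E]
  refine Finset.sum_congr rfl fun z _ => ?_
  rw [hrs]
  simp [E]

theorem twistedCorrelation_mul {m n : ℕ} [NeZero m] [NeZero n] (h : m.Coprime n)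
    (a b c a' b' c' : ℤ) {r : ZMod m} {s : ZMod n}
    (hrs : ∀ w : ZMod (m * n),
      ZMod.stdAddChar w = ZMod.stdAddChar (r * (ZMod.chineseRemainder h w).1) *
        ZMod.stdAddChar (s * (ZMod.chineseRemainder h w).2)) :
    twistedCorrelation (m * n) a b c a' b' c' 1 =
      twistedCorrelation m a b c a' b' c' r * twistedCorrelation n a b c a' b' c' s := by
  unfold twistedCorrelation
  rw [← sum_mul_comp_equiv_prod (ZMod.chineseRemainder h).toEquiv]
  refine Finset.sum_congr rfl fun u _ => ?_
  have hu : IsUnit u ↔ IsUnit (ZMod.chineseRemainder h u).1 ∧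
      IsUnit (ZMod.chineseRemainder h u).2 := by
    rw [← Prod.isUnit_iff, MulEquiv.isUnit_map]
  simp only [hu, twistedSum_mul h _ _ _ hrs, map_mul, ite_and, RingEquiv.toEquiv_eq_coe,
    RingEquiv.coe_toEquiv, ite_mul, mul_ite, zero_mul, mul_zero]
  split_ifs <;> ring

/-- The function `q ↦ S_{𝐚,𝐛,𝐜}(q)` is multiplicative:
if `gcd(q,q′) = 1` then `S(qq′) = S(q) S(q′)`. -/
theorem stmt3 (a b c a' b' c' : ℤ) (q q' : ℕ) (hq : 1 ≤ q) (hq' : 1 ≤ q')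
    (hqq' : Nat.Coprime q q') :
    Sabc a b c a' b' c' (q * q') = Sabc a b c a' b' c' q * Sabc a b c a' b' c' q' := by
  have : NeZero q := ⟨by omega⟩
  have : NeZero q' := ⟨by omega⟩
  obtain ⟨r, s, hrs⟩ := exists_stdAddChar_mul q q' hqq'
  simp only [Sabc_eq_twistedCorrelation]
  rw [twistedCorrelation_mul hqq' a b c a' b' c' hrs, twistedCorrelation_eq_one_twist,
    twistedCorrelation_eq_one_twist]
end

section
/- Let a, b, c be integers and let q, q′ ≥ 1 be integers with gcd(q, q′) = 1. Let h, h′ be integers with gcd(h, q) = gcd(h′, q′) = 1. Then R_{a,b,c}((hq′ + h′q)/(qq′)) = R_{a,b,c}(hq′³/q) · R_{a,b,c}(h′q³/q′). -/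
open scoped BigOperators

/-- A function depending only on residues modulo `N` has the same sum over any
complete residue system as over `range N`. -/
theorem sum_complete_residues {ι M : Type*} [AddCommMonoid M] {N : ℕ} (hN : 0 < N)
    {f : ℕ → M} (hf : ∀ m n, m ≡ n [MOD N] → f m = f n) {s : Finset ι} {g : ι → ℕ}
    (hcard : s.card = N) (hg : ∀ i ∈ s, ∀ j ∈ s, g i ≡ g j [MOD N] → i = j) :
    ∑ i ∈ s, f (g i) = ∑ n ∈ Finset.range N, f n := by
  have hinj : Set.InjOn (fun i => g i % N) s := fun i hi j hj hij => hg i hi j hj hij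
  have himage : s.image (fun i => g i % N) = Finset.range N := by
    apply Finset.eq_of_subset_of_card_le
    · intro n hn
      obtain ⟨i, -, rfl⟩ := Finset.mem_image.1 hn
      exact Finset.mem_range.2 (Nat.mod_lt _ hN)
    · rw [Finset.card_image_of_injOn hinj, hcard, Finset.card_range]
  rw [← himage, Finset.sum_image hinj]
  exact Finset.sum_congr rfl fun i _ => hf _ _ (Nat.mod_modEq _ _).symm

theorem eq_of_modEq_of_mem_Icc {N m n : ℕ} (hm : m ∈ Finset.Icc 1 N) (hn : n ∈ Finset.Icc 1 N)
    (h : m ≡ n [MOD N]) : m = n := by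
  rw [Finset.mem_Icc] at hm hn
  have hdvd := Nat.modEq_iff_dvd.1 h
  have := Int.eq_zero_of_abs_lt_dvd hdvd (abs_lt.2 ⟨by omega, by omega⟩)
  omega

/-- The substitution `n = x q' + x' q` in a sum over residues modulo `q q'`. -/
theorem sum_Icc_mul_of_coprime {M : Type*} [AddCommMonoid M] {q q' : ℕ} (hq : 0 < q)
    (hq' : 0 < q') (hqq' : Nat.Coprime q q') {f : ℕ → M}
    (hf : ∀ m n, m ≡ n [MOD q * q'] → f m = f n) :
    ∑ n ∈ Finset.Icc 1 (q * q'), f n =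
      ∑ x ∈ Finset.Icc 1 q, ∑ x' ∈ Finset.Icc 1 q', f (x * q' + x' * q) := by
  have hN : 0 < q * q' := Nat.mul_pos hq hq'
  rw [← Finset.sum_product' (f := fun x x' => f (x * q' + x' * q)),
    sum_complete_residues hN hf (g := fun p : ℕ × ℕ => p.1 * q' + p.2 * q) (by simp)]
  · exact sum_complete_residues hN hf (g := id) (by simp)
      fun m hm n hn h => eq_of_modEq_of_mem_Icc hm hn h
  · rintro ⟨x, x'⟩ hx ⟨y, y'⟩ hy h
    rw [Finset.mem_product] at hx hy
    refine Prod.ext (eq_of_modEq_of_mem_Icc hx.1 hy.1 ?_) (eq_of_modEq_of_mem_Icc hx.2 hy.2 ?_)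
    · have h₁ : x * q' + x' * q ≡ y * q' + y' * q [MOD q] := h.of_mul_right q'
      refine Nat.ModEq.cancel_right_of_coprime hqq' ?_
      simpa [Nat.ModEq] using h₁
    · have h₁ : x * q' + x' * q ≡ y * q' + y' * q [MOD q'] := h.of_mul_left q
      refine Nat.ModEq.cancel_right_of_coprime hqq'.symm ?_
      simpa [Nat.ModEq] using h₁

theorem e_add (s t : ℝ) : e (s + t) = e s * e t := by
  rw [e, e, e, ← Complex.exp_add]
  congr 1
  push_cast
  ring

theorem e_add_intCast (t : ℝ) (k : ℤ) : e (t + k) = e t := by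
  rw [e, e, Complex.exp_eq_exp_iff_exists_int]
  refine ⟨k, ?_⟩
  push_cast
  ring

theorem e_div_eq_of_modEq {N : ℕ} (hN : 0 < N) {m n : ℤ} (h : m ≡ n [ZMOD N]) :
    e ((m : ℝ) / N) = e ((n : ℝ) / N) := by
  obtain ⟨k, hk⟩ := Int.modEq_iff_dvd.1 h
  obtain rfl : n = m + N * k := by linarith
  have hN' : (N : ℝ) ≠ 0 := by positivity
  rw [← e_add_intCast _ k]
  congr 1
  push_cast
  field_simp

theorem e_cubic_mul {q q' : ℕ} (hq : 0 < q) (hq' : 0 < q') (a b c h h' : ℤ)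
    (x x' y y' z z' : ℕ) :
    e (((a * ((x * q' + x' * q : ℕ) : ℤ) + b * ((y * q' + y' * q : ℕ) : ℤ)
        + c * ((z * q' + z' * q : ℕ) : ℤ)
        - (h * q' + h' * q) * ((x * q' + x' * q : ℕ) : ℤ) * ((y * q' + y' * q : ℕ) : ℤ)
          * ((z * q' + z' * q : ℕ) : ℤ) : ℤ) : ℝ) / (q * q' : ℕ)) =
      e (((a * x + b * y + c * z - h * (q' : ℤ) ^ 3 * x * y * z : ℤ) : ℝ) / q) *
        e (((a * x' + b * y' + c * z' - h' * (q : ℤ) ^ 3 * x' * y' * z' : ℤ) : ℝ) / q') := by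
  have hqr : (q : ℝ) ≠ 0 := by positivity
  have hqr' : (q' : ℝ) ≠ 0 := by positivity
  rw [← e_add, ← e_add_intCast (_ + _)
    (-h * (x' * (y * q') * (z * q') + x * q' * y' * (z * q') + x * q' * (y * q') * z'
          + q * (x' * y' * (z * q') + x' * (y * q') * z' + x * q' * y' * z')
          + q ^ 2 * (x' * y' * z'))
      - h' * (x * (y' * q) * (z' * q) + x' * q * y * (z' * q) + x' * q * (y' * q) * z
          + q' * (x * y * (z' * q) + x * (y' * q) * z + x' * q * y * z)
          + q' ^ 2 * (x * y * z)))]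
  congr 1
  push_cast
  field_simp
  ring

/-- For `gcd(q,q′) = 1`, `gcd(h,q) = 1`, `gcd(h′,q′) = 1`:
`R_{a,b,c}((hq′ + h′q)/(qq′)) = R_{a,b,c}(hq′³/q) · R_{a,b,c}(h′q³/q′)`. -/
theorem stmt4 (a b c : ℤ) (q q' : ℕ) (hq : 1 ≤ q) (hq' : 1 ≤ q')
    (hqq' : Nat.Coprime q q') (h h' : ℤ)
    (hh : Int.gcd h q = 1) (hh' : Int.gcd h' q' = 1) :
    Rabc a b c (h * q' + h' * q) (q * q') =
      Rabc a b c (h * (q' : ℤ) ^ 3) q * Rabc a b c (h' * (q : ℤ) ^ 3) q' := by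
  have hN : 0 < q * q' := Nat.mul_pos hq hq'
  have key : ∀ {f : ℕ → ℂ}, (∀ m n, m ≡ n [MOD q * q'] → f m = f n) →
      ∑ n ∈ Finset.Icc 1 (q * q'), f n =
        ∑ x ∈ Finset.Icc 1 q, ∑ x' ∈ Finset.Icc 1 q', f (x * q' + x' * q) :=
    sum_Icc_mul_of_coprime hq hq' hqq'
  unfold Rabc
  simp only [Finset.sum_mul_sum]
  rw [key]
  · refine Finset.sum_congr rfl fun x _ => Finset.sum_congr rfl fun x' _ => ?_
    rw [key]
    · refine Finset.sum_congr rfl fun y _ => Finset.sum_congr rfl fun y' _ => ?_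
      rw [key]
      · exact Finset.sum_congr rfl fun z _ => Finset.sum_congr rfl fun z' _ =>
          e_cubic_mul hq hq' a b c h h' x x' y y' z z'
      · intro m n hmn
        have := Int.natCast_modEq_iff.2 hmn
        exact e_div_eq_of_modEq hN (by gcongr)
    · intro m n hmn
      have := Int.natCast_modEq_iff.2 hmn
      exact Finset.sum_congr rfl fun z _ => e_div_eq_of_modEq hN (by gcongr)
  · intro m n hmn
    have := Int.natCast_modEq_iff.2 hmn
    exact Finset.sum_congr rfl fun y _ => Finset.sum_congr rfl fun z _ =>
      e_div_eq_of_modEq hN (by gcongr)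
end

section
/- Let p be a prime and q = p^k a power of p; let a, a′, b, b′ be integers. Set 𝓑 = gcd(q, b, b′), B = b/𝓑, B′ = b′/𝓑, and 𝒮 = Σ′_{X,X′=1}^{q} e((aX − a′X′)/q) · c_q(bX − b′X′). If p divides BB′, then 𝒮 = c_q(𝓑) · c_q(a) · c_q(a′). -/
open scoped BigOperators

/-- Ramanujan's sum `c_q(n) = Σ′_{a=1}^{q} e(an/q)` -/
noncomputable def ramanujanSum (q : ℕ) (n : ℤ) : ℂ :=
  ∑ a ∈ (Finset.Icc 1 q).filter (fun a => Nat.Coprime a q), e ((((a : ℤ) * n : ℤ) : ℝ) / q)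

/-- `𝒮 = Σ′_{X,X′=1}^{q} e((aX − a′X′)/q) · c_q(bX − b′X′)` -/
noncomputable def Ssum (q : ℕ) (a a' b b' : ℤ) : ℂ :=
  ∑ X ∈ (Finset.Icc 1 q).filter (fun X => Nat.Coprime X q),
    ∑ X' ∈ (Finset.Icc 1 q).filter (fun X' => Nat.Coprime X' q),
      e (((a * X - a' * X' : ℤ) : ℝ) / q) * ramanujanSum q (b * X - b' * X')

lemma e_int_div_eq_stdAddChar (q : ℕ) [NeZero q] (n : ℤ) :
    e ((n : ℝ) / q) = ZMod.stdAddChar (n : ZMod q) := by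
  rw [ZMod.stdAddChar_coe, e]
  congr 1
  push_cast
  ring

lemma ramanujanSum_eq_sum_units (q : ℕ) [NeZero q] (n : ℤ) :
    ramanujanSum q n = ∑ u : (ZMod q)ˣ, ZMod.stdAddChar ((u : ZMod q) * (n : ZMod q)) := by
  have hq : 0 < q := Nat.pos_of_neZero q
  refine Finset.sum_bij
    (fun a ha => ZMod.unitOfCoprime a (Finset.mem_filter.mp ha).2) (by simp) ?_ ?_ ?_
  · intro a ha b hb hab
    have hab' : (a : ZMod q) = b := by simpa using congrArg Units.val hab
    rw [ZMod.natCast_eq_natCast_iff] at hab'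
    simp only [Finset.mem_filter, Finset.mem_Icc] at ha hb
    have hsub : a - 1 ≡ b - 1 [MOD q] := by
      refine Nat.ModEq.add_right_cancel' 1 ?_
      rwa [Nat.sub_add_cancel ha.1.1, Nat.sub_add_cancel hb.1.1]
    have := Nat.ModEq.eq_of_lt_of_lt hsub (by omega) (by omega)
    omega
  · intro u _
    have hu := ZMod.val_coe_unit_coprime u
    rcases Nat.eq_zero_or_pos (u : ZMod q).val with h0 | hpos
    · have h1 : q = 1 := by simpa [h0] using hu
      subst h1
      exact ⟨1, by simp, Subsingleton.elim _ _⟩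
    · refine ⟨(u : ZMod q).val, ?_, ?_⟩
      · simp only [Finset.mem_filter, Finset.mem_Icc]
        exact ⟨⟨hpos, (ZMod.val_lt _).le⟩, hu⟩
      · ext
        simp
  · intro a ha
    rw [e_int_div_eq_stdAddChar]
    simp

lemma ramanujanSum_congr {q : ℕ} [NeZero q] {m n : ℤ} (h : (m : ZMod q) = n) :
    ramanujanSum q m = ramanujanSum q n := by
  simp only [ramanujanSum_eq_sum_units, h]

lemma ramanujanSum_mul_of_isCoprime {q : ℕ} [NeZero q] (n : ℤ) {m : ℤ}
    (hm : IsCoprime m (q : ℤ)) : ramanujanSum q (n * m) = ramanujanSum q n := by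
  have hu : IsUnit (m : ZMod q) := (ZMod.coe_int_isUnit_iff_isCoprime m q).2 hm.symm
  obtain ⟨v, hv⟩ := hu
  simp only [ramanujanSum_eq_sum_units]
  refine Fintype.sum_equiv (Equiv.mulLeft v) _ _ fun u => ?_
  simp only [Int.cast_mul, ← hv, Equiv.coe_mulLeft, Units.val_mul]
  congr 1
  ring

lemma ramanujanSum_neg (q : ℕ) [NeZero q] (n : ℤ) :
    ramanujanSum q (-n) = ramanujanSum q n := by
  simpa using ramanujanSum_mul_of_isCoprime (q := q) n (m := -1) isCoprime_one_left.neg_left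

/-- If the Ramanujan sum in `Ssum` takes a constant value, `Ssum` factors. -/
lemma Ssum_eq_mul_of_ramanujanSum_eq {q : ℕ} [NeZero q] (a a' : ℤ) {b b' : ℤ} {c : ℂ}
    (h : ∀ X X' : ℕ, X.Coprime q → X'.Coprime q → ramanujanSum q (b * X - b' * X') = c) :
    Ssum q a a' b b' = c * ramanujanSum q a * ramanujanSum q a' := by
  rw [← ramanujanSum_neg q a', mul_assoc]
  conv_rhs => rw [ramanujanSum, ramanujanSum, Finset.sum_mul_sum, Finset.mul_sum]
  refine Finset.sum_congr rfl fun X hX => ?_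
  rw [Finset.mul_sum]
  refine Finset.sum_congr rfl fun X' hX' => ?_
  rw [h X X' (Finset.mem_filter.mp hX).2 (Finset.mem_filter.mp hX').2, mul_comm]
  simp only [e_int_div_eq_stdAddChar]
  rw [← AddChar.map_add_eq_mul]
  congr 2
  push_cast
  ring

/-- For `q = p^k` a prime power, with `𝓑 = gcd(q,b,b′)`, `B = b/𝓑`,
`B′ = b′/𝓑`: if `p ∣ BB′` then `𝒮 = c_q(𝓑) c_q(a) c_q(a′)`. -/
theorem stmt5 (p : ℕ) (hp : p.Prime) (k : ℕ) (q : ℕ) (hq : q = p ^ k)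
    (a a' b b' : ℤ)
    (𝓑 : ℕ) (h𝓑 : 𝓑 = Nat.gcd q (Int.gcd b b'))
    (B B' : ℤ) (hB : B = b / 𝓑) (hB' : B' = b' / 𝓑)
    (hdvd : (p : ℤ) ∣ B * B') :
    Ssum q a a' b b' = ramanujanSum q (𝓑 : ℤ) * ramanujanSum q a * ramanujanSum q a' := by
  have hq0 : q ≠ 0 := hq ▸ pow_ne_zero k hp.ne_zero
  have : NeZero q := ⟨hq0⟩
  have hp' : Prime (p : ℤ) := Nat.prime_iff_prime_int.mp hp
  have h𝓑q : 𝓑 ∣ q := h𝓑 ▸ Nat.gcd_dvd_left _ _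
  have h𝓑g : 𝓑 ∣ Int.gcd b b' := h𝓑 ▸ Nat.gcd_dvd_right _ _
  have hb : b = 𝓑 * B := by
    rw [hB, Int.mul_ediv_cancel' ((Int.natCast_dvd_natCast.mpr h𝓑g).trans (Int.gcd_dvd_left _ _))]
  have hb' : b' = 𝓑 * B' := by
    rw [hB', Int.mul_ediv_cancel' ((Int.natCast_dvd_natCast.mpr h𝓑g).trans (Int.gcd_dvd_right _ _))]
  refine Ssum_eq_mul_of_ramanujanSum_eq a a' fun X X' hX hX' => ?_
  rw [hb, hb', mul_assoc, mul_assoc, ← mul_sub]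
  by_cases h𝓑_eq : 𝓑 = q
  · refine ramanujanSum_congr ?_
    simp [h𝓑_eq]
  · refine ramanujanSum_mul_of_isCoprime _ ?_
    obtain ⟨j, hj, h𝓑j⟩ := (Nat.dvd_prime_pow hp).mp (hq ▸ h𝓑q)
    have hjk : j < k := lt_of_le_of_ne hj fun h => h𝓑_eq (by rw [h𝓑j, hq, h])
    have hpq : p ∣ q := hq ▸ dvd_pow_self p (by omega)
    have hnot : ¬ ((p : ℤ) ∣ B ∧ (p : ℤ) ∣ B') := by
      rintro ⟨h1, h2⟩
      have hdiv : 𝓑 * p ∣ 𝓑 := by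
        conv_rhs => rw [h𝓑]
        refine Nat.dvd_gcd ?_ (Int.dvd_gcd ?_ ?_)
        · rw [h𝓑j, hq, ← pow_succ]
          exact pow_dvd_pow p hjk
        · rw [hb]
          push_cast
          exact mul_dvd_mul_left _ h1
        · rw [hb']
          push_cast
          exact mul_dvd_mul_left _ h2
      have h𝓑pos : 0 < 𝓑 := Nat.pos_of_dvd_of_pos h𝓑q (Nat.pos_of_ne_zero hq0)
      have := Nat.le_of_dvd h𝓑pos hdiv
      nlinarith [hp.two_le]
    have hunit : ∀ {Y : ℕ}, Y.Coprime q → ¬ (p : ℤ) ∣ Y := fun hY h =>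
      hp.ne_one (Nat.dvd_one.mp (hY ▸ Nat.dvd_gcd (Int.natCast_dvd_natCast.mp h) hpq))
    rw [hq, Nat.cast_pow]
    refine (IsCoprime.pow_left ((hp'.irreducible.coprime_iff_not_dvd).2 fun h => ?_)).symm
    rcases hp'.dvd_or_dvd hdvd with h1 | h1
    · have h2 : (p : ℤ) ∣ B' * X' := (dvd_sub_right (h1.mul_right _)).mp h
      exact (hp'.dvd_or_dvd h2).elim (fun h3 => hnot ⟨h1, h3⟩) (hunit hX')
    · have h2 : (p : ℤ) ∣ B * X := (dvd_sub_left (h1.mul_right _)).mp h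
      exact (hp'.dvd_or_dvd h2).elim (fun h3 => hnot ⟨h3, h1⟩) (hunit hX)
end

section
/- Let p be a prime and q = p^k a power of p; let a, a′, b, b′ be integers. Set 𝓑 = gcd(q, b, b′), Q = q/𝓑, B = b/𝓑, B′ = b′/𝓑, 𝓐 = gcd(q, a), 𝓐′ = gcd(q, a′), and 𝒮 = Σ′_{X,X′=1}^{q} e((aX − a′X′)/q) · c_q(bX − b′X′). If p does not divide BB′ and p² divides Q, then 𝒮 = q · c_{q𝓑}(ab′ − a′b) if 𝓑 = 𝓐 = 𝓐′, and 𝒮 = 0 otherwise. -/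
open scoped BigOperators

theorem e_nat_mul (n : ℕ) (t : ℝ) : e (n * t) = e t ^ n := by
  simp only [e, ← Complex.exp_nat_mul]
  congr 1
  push_cast
  ring

theorem e_eq_one_iff (t : ℝ) : e t = 1 ↔ ∃ m : ℤ, t = m := by
  have h : (2 * Real.pi * Complex.I : ℂ) ≠ 0 := Complex.two_pi_I_ne_zero
  rw [e, Complex.exp_eq_one_iff]
  refine exists_congr fun m => ⟨fun hm => ?_, fun hm => ?_⟩
  · rw [mul_comm] at hm
    exact_mod_cast mul_right_cancel₀ h hm
  · rw [hm, Complex.ofReal_intCast, mul_comm]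

theorem e_int_div_eq_one_iff {q : ℕ} (hq : q ≠ 0) (n : ℤ) :
    e ((n : ℝ) / q) = 1 ↔ (q : ℤ) ∣ n := by
  have hq' : (q : ℝ) ≠ 0 := by exact_mod_cast hq
  rw [e_eq_one_iff]
  refine exists_congr fun m => ?_
  rw [div_eq_iff hq', mul_comm]
  exact_mod_cast Iff.rfl

theorem sum_Icc_pow_mul_sub_one (z : ℂ) (n : ℕ) :
    (∑ a ∈ Finset.Icc 1 n, z ^ a) * (z - 1) = z ^ (n + 1) - z := by
  induction n with
  | zero => simp
  | succ n ih => rw [Finset.sum_Icc_succ_top (by omega), add_mul, ih]; ring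

/-- Orthogonality of the additive characters modulo `q`. -/
theorem sum_e_mul_div {q : ℕ} (hq : q ≠ 0) (n : ℤ) :
    ∑ a ∈ Finset.Icc 1 q, e ((((a : ℤ) * n : ℤ) : ℝ) / q) = if (q : ℤ) ∣ n then (q : ℂ) else 0 := by
  have hpow (a : ℕ) : e ((((a : ℤ) * n : ℤ) : ℝ) / q) = e ((n : ℝ) / q) ^ a := by
    rw [← e_nat_mul]
    congr 1
    push_cast
    ring
  simp only [hpow]
  split_ifs with h
  · simp [(e_int_div_eq_one_iff hq n).2 h]
  · have h1 : e ((n : ℝ) / q) - 1 ≠ 0 := sub_ne_zero.2 (mt (e_int_div_eq_one_iff hq n).1 h)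
    have hq1 : e ((n : ℝ) / q) ^ q = 1 := by
      rw [← hpow, e_int_div_eq_one_iff hq]
      exact dvd_mul_right _ _
    have := sum_Icc_pow_mul_sub_one (e ((n : ℝ) / q)) q
    rw [pow_succ, hq1, one_mul, sub_self] at this
    exact (mul_eq_zero.1 this).resolve_right h1

/-- The normalised Ramanujan sum `c_{p^{l+1}}(n) / p^l`. -/
noncomputable def normRamanujan (p l : ℕ) (n : ℤ) : ℂ :=
  p * (if (p : ℤ) ^ (l + 1) ∣ n then 1 else 0) - (if (p : ℤ) ^ l ∣ n then 1 else 0)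

theorem normRamanujan_congr {p l : ℕ} {m n : ℤ}
    (h : ∀ i ≤ l + 1, (p : ℤ) ^ i ∣ m ↔ (p : ℤ) ^ i ∣ n) :
    normRamanujan p l m = normRamanujan p l n := by
  simp only [normRamanujan, h (l + 1) le_rfl, h l (Nat.le_succ l)]

theorem normRamanujan_neg (p l : ℕ) (n : ℤ) : normRamanujan p l (-n) = normRamanujan p l n :=
  normRamanujan_congr fun _ _ => dvd_neg

theorem normRamanujan_eq_zero {p l : ℕ} {n : ℤ} (h : ¬ (p : ℤ) ^ l ∣ n) :
    normRamanujan p l n = 0 := by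
  have h' : ¬ (p : ℤ) ^ (l + 1) ∣ n := fun h1 => h ((pow_dvd_pow _ (Nat.le_succ l)).trans h1)
  simp [normRamanujan, h, h']

theorem normRamanujan_pow_mul {p : ℕ} (hp : p ≠ 0) (j l : ℕ) (n : ℤ) :
    normRamanujan p (j + l) ((p : ℤ) ^ j * n) = normRamanujan p l n := by
  have hpj : (p : ℤ) ^ j ≠ 0 := pow_ne_zero _ (by exact_mod_cast hp)
  simp only [normRamanujan, add_assoc, pow_add _ j, mul_dvd_mul_iff_left hpj]

theorem coprime_prime_pow_succ_iff {p : ℕ} (hp : p.Prime) (a l : ℕ) :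
    a.Coprime (p ^ (l + 1)) ↔ ¬ p ∣ a := by
  rw [Nat.coprime_pow_right_iff l.succ_pos, Nat.coprime_comm, hp.coprime_iff_not_dvd]

theorem sum_filter_dvd_eq {p : ℕ} (hp : 0 < p) (l : ℕ) (f : ℕ → ℂ) :
    ∑ a ∈ (Finset.Icc 1 (p ^ (l + 1))).filter (p ∣ ·), f a
      = ∑ a ∈ Finset.Icc 1 (p ^ l), f (p * a) := by
  symm
  refine Finset.sum_nbij (p * ·) (fun a ha => ?_) (fun a _ b _ h => Nat.eq_of_mul_eq_mul_left hp h)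
    (fun a ha => ?_) (fun _ _ => rfl)
  · simp only [Finset.mem_filter, Finset.mem_Icc] at ha ⊢
    refine ⟨⟨Nat.mul_pos hp ha.1, ?_⟩, dvd_mul_right _ _⟩
    rw [pow_succ']
    exact Nat.mul_le_mul_left _ ha.2
  · simp only [Finset.coe_filter, Finset.mem_Icc, Set.mem_ofPred_eq] at ha
    obtain ⟨⟨h1, h2⟩, c, rfl⟩ := ha
    refine ⟨c, ?_, rfl⟩
    rw [pow_succ'] at h2
    simpa using ⟨Nat.pos_of_mul_pos_left h1, Nat.le_of_mul_le_mul_left h2 hp⟩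

theorem ramanujanSum_prime_pow {p : ℕ} (hp : p.Prime) (l : ℕ) (n : ℤ) :
    ramanujanSum (p ^ (l + 1)) n = p ^ l * normRamanujan p l n := by
  have hp0 : (p : ℝ) ≠ 0 := by exact_mod_cast hp.ne_zero
  have hsplit := Finset.sum_filter_add_sum_filter_not (Finset.Icc 1 (p ^ (l + 1))) (p ∣ ·)
    fun a : ℕ => e ((((a : ℤ) * n : ℤ) : ℝ) / (p ^ (l + 1) : ℕ))
  have hterm (a : ℕ) : e (((((p * a : ℕ) : ℤ) * n : ℤ) : ℝ) / (p ^ (l + 1) : ℕ))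
      = e ((((a : ℤ) * n : ℤ) : ℝ) / (p ^ l : ℕ)) := by
    congr 1
    push_cast
    rw [pow_succ', mul_assoc, mul_div_mul_left _ _ hp0]
  rw [sum_filter_dvd_eq hp.pos, sum_e_mul_div (pow_ne_zero _ hp.ne_zero)] at hsplit
  simp only [hterm] at hsplit
  rw [sum_e_mul_div (pow_ne_zero _ hp.ne_zero)] at hsplit
  simp only [ramanujanSum, coprime_prime_pow_succ_iff hp]
  rw [eq_sub_of_add_eq' hsplit, normRamanujan]
  push_cast
  split_ifs <;> ring

/-- Opening the inner Ramanujan sum factors the sums over `X` and `X'`. -/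
theorem Ssum_eq_sum_ramanujanSum_mul (q : ℕ) (a a' b b' : ℤ) :
    Ssum q a a' b b' = ∑ u ∈ (Finset.Icc 1 q).filter (fun u => Nat.Coprime u q),
      ramanujanSum q (a + u * b) * ramanujanSum q (-(a' + u * b')) := by
  simp only [Ssum, ramanujanSum, Finset.sum_mul_sum]
  simp only [Finset.mul_sum]
  rw [Finset.sum_congr rfl fun _ _ => Finset.sum_comm, Finset.sum_comm]
  refine Finset.sum_congr rfl fun u _ => Finset.sum_congr rfl fun X _ =>
    Finset.sum_congr rfl fun X' _ => ?_
  rw [← e_add, ← e_add]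
  congr 1
  push_cast
  ring

theorem card_filter_dvd_sub {d n : ℕ} (hd : 0 < d) (v : ℕ) :
    ((Finset.Icc 1 (d * n)).filter fun u : ℕ => (d : ℤ) ∣ (u : ℤ) - v).card = n := by
  have h := Nat.Ioc_filter_modEq_card 0 (d * n) hd v
  have hd' : (d : ℚ) ≠ 0 := by exact_mod_cast hd.ne'
  have hfloor : (((d * n : ℕ) : ℚ) - v) / d = ((0 : ℕ) - v : ℚ) / d + n := by
    push_cast
    field_simp
    ring
  rw [hfloor, Int.floor_add_natCast, add_sub_cancel_left, max_eq_left (Int.natCast_nonneg n)] at h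
  rw [← Nat.cast_inj (R := ℤ), ← h]
  congr 2
  ext u
  simp only [Finset.mem_filter, Finset.mem_Icc, Finset.mem_Ioc, Nat.modEq_iff_dvd, Nat.succ_le_iff,
    dvd_sub_comm (b := (u : ℤ))]

theorem sum_ite_dvd_sub_mul_ite_dvd_sub {p : ℕ} (hp : 0 < p) {s r k : ℕ} (hsr : s ≤ r) (v w : ℕ) :
    ∑ u ∈ Finset.Icc 1 (p ^ (r + k)), ((if (p : ℤ) ^ r ∣ (u : ℤ) - v then 1 else 0)
      * (if (p : ℤ) ^ s ∣ (u : ℤ) - w then 1 else 0) : ℂ)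
      = p ^ k * (if (p : ℤ) ^ s ∣ (v : ℤ) - w then 1 else 0) := by
  have hterm (u : ℕ) : ((if (p : ℤ) ^ r ∣ (u : ℤ) - v then 1 else 0)
      * (if (p : ℤ) ^ s ∣ (u : ℤ) - w then 1 else 0) : ℂ)
      = (if (p : ℤ) ^ r ∣ (u : ℤ) - v then 1 else 0)
        * (if (p : ℤ) ^ s ∣ (v : ℤ) - w then 1 else 0) := by
    by_cases h : (p : ℤ) ^ r ∣ (u : ℤ) - v
    · have h' : (p : ℤ) ^ s ∣ (u : ℤ) - w ↔ (p : ℤ) ^ s ∣ (v : ℤ) - w := by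
        rw [← sub_add_sub_cancel (u : ℤ) v w]
        exact dvd_add_right ((pow_dvd_pow _ hsr).trans h)
      simp only [h']
    · simp [h]
  have hcard := card_filter_dvd_sub (n := p ^ k) (pow_pos hp r) v
  rw [← pow_add] at hcard
  push_cast at hcard
  rw [Finset.sum_congr rfl fun u _ => hterm u, ← Finset.sum_mul, Finset.sum_boole, hcard]
  push_cast
  rfl

theorem sum_normRamanujan_mul_normRamanujan {p : ℕ} (hp : 0 < p) (j l v w : ℕ) :
    ∑ u ∈ Finset.Icc 1 (p ^ (j + l + 1)),
      normRamanujan p l ((u : ℤ) - v) * normRamanujan p l ((u : ℤ) - w)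
      = p ^ (j + 1) * normRamanujan p l ((v : ℤ) - w) := by
  have h11 := sum_ite_dvd_sub_mul_ite_dvd_sub hp (k := j) (le_refl (l + 1)) v w
  have h10 := sum_ite_dvd_sub_mul_ite_dvd_sub hp (k := j) (Nat.le_succ l) v w
  have h01 := sum_ite_dvd_sub_mul_ite_dvd_sub hp (k := j) (Nat.le_succ l) w v
  have h00 := sum_ite_dvd_sub_mul_ite_dvd_sub hp (k := j + 1) (le_refl l) v w
  rw [show l.succ + j = j + l + 1 by omega] at h10 h01
  rw [show l + 1 + j = j + l + 1 by omega] at h11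
  rw [show l + (j + 1) = j + l + 1 by omega] at h00
  simp only [dvd_sub_comm (b := (w : ℤ)) (c := (v : ℤ)), Nat.succ_eq_add_one] at h01 h10
  have hexpand (u : ℕ) : normRamanujan p l ((u : ℤ) - v) * normRamanujan p l ((u : ℤ) - w)
      = (p : ℂ) ^ 2 * ((if (p : ℤ) ^ (l + 1) ∣ (u : ℤ) - v then 1 else 0)
          * (if (p : ℤ) ^ (l + 1) ∣ (u : ℤ) - w then 1 else 0))
        - p * ((if (p : ℤ) ^ (l + 1) ∣ (u : ℤ) - v then 1 else 0)
          * (if (p : ℤ) ^ l ∣ (u : ℤ) - w then 1 else 0))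
        - p * ((if (p : ℤ) ^ (l + 1) ∣ (u : ℤ) - w then 1 else 0)
          * (if (p : ℤ) ^ l ∣ (u : ℤ) - v then 1 else 0))
        + ((if (p : ℤ) ^ l ∣ (u : ℤ) - v then 1 else 0)
          * (if (p : ℤ) ^ l ∣ (u : ℤ) - w then 1 else 0)) := by
    simp only [normRamanujan]
    ring
  simp only [hexpand, Finset.sum_add_distrib, Finset.sum_sub_distrib, ← Finset.mul_sum,
    h11, h10, h01, h00]
  rw [normRamanujan]
  ring

theorem gcd_prime_pow_mul_eq {p : ℕ} (hp : p.Prime) (j m : ℕ) {A : ℤ} (hA : ¬ (p : ℤ) ∣ A) :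
    Int.gcd ((p ^ (j + m) : ℕ) : ℤ) ((p : ℤ) ^ j * A) = p ^ j := by
  have hc : IsCoprime ((p : ℤ) ^ m) A :=
    ((Nat.prime_iff_prime_int.1 hp).coprime_iff_not_dvd.2 hA).pow_left
  push_cast
  rw [pow_add, Int.gcd_mul_left, Int.isCoprime_iff_gcd_eq_one.1 hc]
  simp [Int.natAbs_pow]

theorem exists_nat_pow_dvd_add_mul_iff {p : ℕ} (hp : p.Prime) (m : ℕ) (A : ℤ) {B : ℤ}
    (hB : ¬ (p : ℤ) ∣ B) :
    ∃ v : ℕ, (p : ℤ) ^ m ∣ A + v * B ∧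
      ∀ u : ℤ, ∀ i ≤ m, (p : ℤ) ^ i ∣ A + u * B ↔ (p : ℤ) ^ i ∣ u - v := by
  have hcop (i : ℕ) : IsCoprime ((p : ℤ) ^ i) B :=
    ((Nat.prime_iff_prime_int.1 hp).coprime_iff_not_dvd.2 hB).pow_left
  obtain ⟨x, y, hxy⟩ := hcop m
  have hpm : (p : ℤ) ^ m ≠ 0 := pow_ne_zero _ (by exact_mod_cast hp.ne_zero)
  have hv := Int.toNat_of_nonneg (Int.emod_nonneg (-A * y) hpm)
  set v := ((-A * y) % (p : ℤ) ^ m).toNat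
  have hdvd : (p : ℤ) ^ m ∣ A + v * B := by
    refine ⟨A * x - (-A * y) / (p : ℤ) ^ m * B, ?_⟩
    have := Int.emod_add_mul_ediv (-A * y) ((p : ℤ) ^ m)
    rw [hv]
    linear_combination B * this - A * hxy
  refine ⟨v, hdvd, fun u i hi => ?_⟩
  rw [show A + u * B = (A + v * B) + (u - v) * B by ring,
    dvd_add_right ((pow_dvd_pow _ hi).trans hdvd)]
  exact ⟨(hcop i).dvd_of_dvd_mul_right, fun h => h.mul_right _⟩

theorem Ssum_prime_pow {p : ℕ} (hp : p.Prime) (l : ℕ) (a a' b b' : ℤ) :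
    Ssum (p ^ (l + 1)) a a' b b' = p ^ (2 * l) *
      ∑ u ∈ (Finset.Icc 1 (p ^ (l + 1))).filter (fun u => Nat.Coprime u (p ^ (l + 1))),
        normRamanujan p l (a + u * b) * normRamanujan p l (a' + u * b') := by
  simp only [Ssum_eq_sum_ramanujanSum_mul, ramanujanSum_prime_pow hp, normRamanujan_neg,
    Finset.mul_sum]
  exact Finset.sum_congr rfl fun u _ => by ring

theorem exists_eq_pow_mul_of_gcd_eq {p : ℕ} (hp : p.Prime) {j k : ℕ} (hjk : j < k) {a : ℤ}
    (h : Int.gcd ((p : ℤ) ^ k) a = p ^ j) : ∃ A : ℤ, a = (p : ℤ) ^ j * A ∧ ¬ (p : ℤ) ∣ A := by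
  obtain ⟨A, rfl⟩ : (p : ℤ) ^ j ∣ a := by
    have := Int.gcd_dvd_right ((p : ℤ) ^ k) a
    rw [h] at this
    exact_mod_cast this
  refine ⟨A, rfl, fun hA => ?_⟩
  have hd : (p : ℤ) ^ (j + 1) ∣ (Int.gcd ((p : ℤ) ^ k) ((p : ℤ) ^ j * A) : ℕ) :=
    Int.dvd_coe_gcd (pow_dvd_pow _ hjk) (pow_succ (p : ℤ) j ▸ mul_dvd_mul_left _ hA)
  rw [h] at hd
  have := (Nat.pow_dvd_pow_iff_le_right hp.one_lt).1 (by exact_mod_cast hd : p ^ (j + 1) ∣ p ^ j)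
  omega

theorem gcd_eq_of_normRamanujan_ne_zero {p : ℕ} (hp : p.Prime) {j l u : ℕ} {a B : ℤ}
    (hu : ¬ p ∣ u) (hB : ¬ (p : ℤ) ∣ B)
    (h : normRamanujan p (j + (l + 1)) (a + u * ((p : ℤ) ^ j * B)) ≠ 0) :
    Int.gcd ((p : ℤ) ^ (j + (l + 1) + 1)) a = p ^ j := by
  have hdvd := not_imp_comm.1 normRamanujan_eq_zero h
  obtain ⟨A, rfl⟩ : (p : ℤ) ^ j ∣ a := by
    rw [← dvd_add_left ((dvd_mul_right ((p : ℤ) ^ j) B).mul_left (u : ℤ))]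
    exact (pow_dvd_pow _ (by omega)).trans hdvd
  have hA : ¬ (p : ℤ) ∣ A := fun hA => by
    rw [show (p : ℤ) ^ j * A + u * (p ^ j * B) = p ^ j * (A + u * B) by ring, pow_add,
      mul_dvd_mul_iff_left (pow_ne_zero _ (by exact_mod_cast hp.ne_zero)), pow_succ'] at hdvd
    have := (dvd_add_right hA).1 ((dvd_mul_right _ _).trans hdvd)
    rcases (Nat.prime_iff_prime_int.1 hp).dvd_or_dvd this with h1 | h1
    · exact hu (Int.natCast_dvd_natCast.1 h1)
    · exact hB h1
  exact_mod_cast gcd_prime_pow_mul_eq hp j (l + 1 + 1) hA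

theorem sum_unit_normRamanujan {p : ℕ} (hp : p.Prime) (j l : ℕ) {A A' B B' : ℤ}
    (hA : ¬ (p : ℤ) ∣ A) (hB : ¬ (p : ℤ) ∣ B) (hB' : ¬ (p : ℤ) ∣ B') :
    ∑ u ∈ (Finset.Icc 1 (p ^ (j + (l + 1) + 1))).filter
        (fun u => Nat.Coprime u (p ^ (j + (l + 1) + 1))),
      normRamanujan p (j + (l + 1)) ((p : ℤ) ^ j * A + u * (p ^ j * B))
        * normRamanujan p (j + (l + 1)) ((p : ℤ) ^ j * A' + u * (p ^ j * B'))
      = p ^ (j + 1) * normRamanujan p (l + 1) (A * B' - A' * B) := by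
  obtain ⟨v, hv, hvu⟩ := exists_nat_pow_dvd_add_mul_iff hp (l + 1 + 1) A hB
  obtain ⟨w, hw, hwu⟩ := exists_nat_pow_dvd_add_mul_iff hp (l + 1 + 1) A' hB'
  have hfactor (u : ℕ) (C D : ℤ) : normRamanujan p (j + (l + 1)) ((p : ℤ) ^ j * C + u * (p ^ j * D))
      = normRamanujan p (l + 1) (C + u * D) := by
    rw [← normRamanujan_pow_mul hp.ne_zero j (l + 1) (C + u * D)]
    congr 1
    ring
  simp only [hfactor]
  rw [Finset.sum_filter_of_ne fun u _ hne => ?_]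
  · rw [Finset.sum_congr rfl fun (u : ℕ) _ => congr_arg₂ (· * ·) (normRamanujan_congr (hvu u))
      (normRamanujan_congr (hwu u)), sum_normRamanujan_mul_normRamanujan hp.pos]
    congr 1
    refine normRamanujan_congr fun i hi => ?_
    have hcop : IsCoprime ((p : ℤ) ^ i) B' :=
      ((Nat.prime_iff_prime_int.1 hp).coprime_iff_not_dvd.2 hB').pow_left
    rw [← neg_sub, dvd_neg, ← hvu w i hi, show A * B' - A' * B
      = B' * (A + w * B) - B * (A' + w * B') by ring,
      dvd_sub_left (((pow_dvd_pow _ hi).trans hw).mul_left B)]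
    exact ⟨fun h => h.mul_left _, hcop.dvd_of_dvd_mul_left⟩
  · rw [coprime_prime_pow_succ_iff hp]
    intro hpu
    have hdvd := not_imp_comm.1 normRamanujan_eq_zero (left_ne_zero_of_mul hne)
    refine hA ((dvd_add_left ((Int.natCast_dvd_natCast.2 hpu).mul_right B)).1 ?_)
    exact (dvd_pow_self _ l.succ_ne_zero).trans hdvd

/-- For `q = p^k` a prime power, with `𝓑 = gcd(q,b,b′)`, `Q = q/𝓑`,
`B = b/𝓑`, `B′ = b′/𝓑`, `𝓐 = gcd(q,a)`, `𝓐′ = gcd(q,a′)`: if `p ∤ BB′` and `p² ∣ Q` then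
`𝒮 = q · c_{q𝓑}(ab′ − a′b)` when `𝓑 = 𝓐 = 𝓐′`, and `𝒮 = 0` otherwise. -/
theorem stmt6 (p : ℕ) (hp : p.Prime) (k : ℕ) (q : ℕ) (hq : q = p ^ k)
    (a a' b b' : ℤ)
    (𝓑 : ℕ) (h𝓑 : 𝓑 = Nat.gcd q (Int.gcd b b'))
    (Q : ℕ) (hQ : Q = q / 𝓑)
    (B B' : ℤ) (hB : B = b / 𝓑) (hB' : B' = b' / 𝓑)
    (𝓐 𝓐' : ℕ) (h𝓐 : 𝓐 = Int.gcd (q : ℤ) a) (h𝓐' : 𝓐' = Int.gcd (q : ℤ) a')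
    (hndvd : ¬ (p : ℤ) ∣ B * B') (hQp : p ^ 2 ∣ Q) :
    Ssum q a a' b b' =
      if 𝓑 = 𝓐 ∧ 𝓑 = 𝓐' then (q : ℂ) * ramanujanSum (q * 𝓑) (a * b' - a' * b) else 0 := by
  subst h𝓐 h𝓐' hB hB' hQ hq
  obtain ⟨j, hj, h𝓑j⟩ : ∃ j ≤ k, 𝓑 = p ^ j :=
    (Nat.dvd_prime_pow hp).1 (h𝓑 ▸ Nat.gcd_dvd_left _ _)
  have hdvd : (𝓑 : ℤ) ∣ (Int.gcd b b' : ℕ) :=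
    Int.natCast_dvd_natCast.2 (h𝓑 ▸ Nat.gcd_dvd_right _ _)
  have hb : (𝓑 : ℤ) ∣ b := hdvd.trans (Int.gcd_dvd_left _ _)
  have hb' : (𝓑 : ℤ) ∣ b' := hdvd.trans (Int.gcd_dvd_right _ _)
  clear h𝓑 hdvd
  subst h𝓑j
  rw [Nat.pow_div hj hp.pos, Nat.pow_dvd_pow_iff_le_right hp.one_lt] at hQp
  obtain ⟨l, rfl⟩ : ∃ l, k = j + (l + 1) + 1 := ⟨k - j - 2, by omega⟩
  obtain ⟨B, rfl⟩ := hb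
  obtain ⟨B', rfl⟩ := hb'
  have hpj : ((p ^ j : ℕ) : ℤ) ≠ 0 := by exact_mod_cast pow_ne_zero j hp.ne_zero
  rw [Int.mul_ediv_cancel_left _ hpj, Int.mul_ediv_cancel_left _ hpj] at hndvd
  have hB : ¬ (p : ℤ) ∣ B := fun h => hndvd (h.mul_right _)
  have hB' : ¬ (p : ℤ) ∣ B' := fun h => hndvd (h.mul_left _)
  push_cast at hpj ⊢
  rw [Ssum_prime_pow hp]
  split_ifs with h
  · obtain ⟨A, rfl, hA⟩ := exists_eq_pow_mul_of_gcd_eq hp (by omega) h.1.symm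
    obtain ⟨A', rfl, -⟩ := exists_eq_pow_mul_of_gcd_eq hp (by omega) h.2.symm
    rw [sum_unit_normRamanujan hp _ _ hA hB hB', ← pow_add,
      show j + (l + 1) + 1 + j = (j + (j + (l + 1))) + 1 by omega, ramanujanSum_prime_pow hp,
      show (p : ℤ) ^ j * A * (p ^ j * B') - p ^ j * A' * (p ^ j * B)
        = p ^ j * (p ^ j * (A * B' - A' * B)) by ring,
      normRamanujan_pow_mul hp.ne_zero, normRamanujan_pow_mul hp.ne_zero]
    ring
  · refine mul_eq_zero_of_right _ (Finset.sum_eq_zero fun u hu => ?_)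
    rw [Finset.mem_filter, coprime_prime_pow_succ_iff hp] at hu
    rw [mul_eq_zero]
    by_contra! hne
    exact h ⟨(gcd_eq_of_normRamanujan_ne_zero hp hu.2 hB hne.1).symm,
      (gcd_eq_of_normRamanujan_ne_zero hp hu.2 hB' hne.2).symm⟩
end

section
/- Let p be a prime and q = p^k a power of p; let a, a′, b, b′ be integers. Set 𝓑 = gcd(q, b, b′), Q = q/𝓑, B = b/𝓑, B′ = b′/𝓑, and 𝒮 = Σ′_{X,X′=1}^{q} e((aX − a′X′)/q) · c_q(bX − b′X′). If p does not divide BB′ and Q = p, then 𝒮 = q · c_{q𝓑}(ab′ − a′b) · 𝟙[(q/p) | a and (q/p) | a′] − 𝓑 · c_q(a) · c_q(a′). -/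
open scoped BigOperators

theorem e_intCast_div (N : ℕ) [NeZero N] (n : ℤ) :
    e ((n : ℝ) / N) = ZMod.stdAddChar (n : ZMod N) := by
  rw [ZMod.stdAddChar_coe, e]
  congr 1
  push_cast
  ring

theorem sum_range_natCast_zmod (N : ℕ) [NeZero N] (f : ZMod N → ℂ) :
    ∑ x ∈ Finset.range N, f x = ∑ y : ZMod N, f y :=
  Finset.sum_nbij' (fun x => (x : ZMod N)) ZMod.val (by simp) (by simp [ZMod.val_lt])
    (fun x hx => ZMod.val_cast_of_lt (Finset.mem_range.1 hx)) (by simp) (by simp)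

theorem sum_range_e (N : ℕ) [NeZero N] (n : ℤ) :
    ∑ x ∈ Finset.range N, e (((n * x : ℤ) : ℝ) / N) = if (N : ℤ) ∣ n then (N : ℂ) else 0 := by
  have h := AddChar.sum_mulShift (n : ZMod N) (ZMod.isPrimitive_stdAddChar N)
  rw [ZMod.card, ← sum_range_natCast_zmod N] at h
  simp only [ZMod.intCast_zmod_eq_zero_iff_dvd] at h
  refine Eq.trans (Finset.sum_congr rfl fun x _ => ?_) (h.trans (by split_ifs <;> simp))
  rw [e_intCast_div]
  push_cast
  rw [mul_comm]

theorem sum_coprime_eq_sum_fibers {p : ℕ} (hp : p.Prime) (j : ℕ) (f : ℕ → ℂ) :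
    ∑ X ∈ (Finset.Icc 1 (p ^ (j + 1))).filter (fun X => Nat.Coprime X (p ^ (j + 1))), f X =
      ∑ x ∈ (Finset.range p).filter (fun x => ¬ p ∣ x),
        ∑ u ∈ Finset.range (p ^ j), f (x + p * u) := by
  rw [← Finset.sum_product']
  have hcop : ∀ X : ℕ, Nat.Coprime X (p ^ (j + 1)) ↔ ¬ p ∣ X := fun X => by
    rw [Nat.coprime_pow_right_iff j.succ_pos, Nat.coprime_comm, hp.coprime_iff_not_dvd]
  simp only [hcop]
  refine Finset.sum_nbij' (fun X => (X % p, X / p)) (fun y => y.1 + p * y.2) ?_ ?_ ?_ ?_ ?_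
  · intro X hX
    simp only [Finset.mem_filter, Finset.mem_Icc, Finset.mem_product, Finset.mem_range] at hX ⊢
    obtain ⟨⟨-, hX⟩, hd⟩ := hX
    refine ⟨⟨Nat.mod_lt _ hp.pos, by rwa [Nat.dvd_mod_iff dvd_rfl]⟩, ?_⟩
    rw [Nat.div_lt_iff_lt_mul hp.pos, ← pow_succ]
    exact lt_of_le_of_ne hX fun h => hd (h ▸ dvd_pow_self p j.succ_ne_zero)
  · rintro ⟨x, u⟩ h
    simp only [Finset.mem_filter, Finset.mem_Icc, Finset.mem_product, Finset.mem_range] at h ⊢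
    obtain ⟨⟨hx, hd⟩, hu⟩ := h
    have hx0 : x ≠ 0 := fun h => hd (h ▸ dvd_zero p)
    refine ⟨⟨by lia, ?_⟩, by rwa [Nat.dvd_add_left (dvd_mul_right p u)]⟩
    rw [pow_succ']
    nlinarith
  · intro X _
    exact Nat.mod_add_div X p
  · rintro ⟨x, u⟩ h
    simp only [Finset.mem_filter, Finset.mem_product, Finset.mem_range] at h
    simp [Nat.mod_eq_of_lt h.1.1, Nat.add_mul_div_left _ _ hp.pos, Nat.div_eq_of_lt h.1.1]
  · intro X _
    rw [Nat.mod_add_div]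

theorem sum_fiber_e {p : ℕ} (hp : p.Prime) (j : ℕ) (n : ℤ) (x : ℕ) :
    ∑ u ∈ Finset.range (p ^ j), e (((n * (x + p * u : ℕ) : ℤ) : ℝ) / (p ^ (j + 1) : ℕ)) =
      e (((n * x : ℤ) : ℝ) / (p ^ (j + 1) : ℕ)) *
        if ((p ^ j : ℕ) : ℤ) ∣ n then ((p ^ j : ℕ) : ℂ) else 0 := by
  have : NeZero p := ⟨hp.ne_zero⟩
  rw [← sum_range_e, Finset.mul_sum]
  refine Finset.sum_congr rfl fun u _ => ?_
  rw [← e_add]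
  congr 1
  have : (p : ℝ) ≠ 0 := mod_cast hp.ne_zero
  push_cast
  field_simp
  ring

theorem sum_filter_not_dvd (p : ℕ) [NeZero p] (f : ZMod p → ℂ) :
    ∑ x ∈ (Finset.range p).filter (fun x => ¬ p ∣ x), f x =
      ∑ y : ZMod p with y ≠ 0, f y := by
  simp only [Finset.sum_filter, ne_eq]
  rw [← sum_range_natCast_zmod]
  simp only [ZMod.natCast_eq_zero_iff]

theorem sum_stdAddChar_ne_zero (p : ℕ) [NeZero p] (n : ℤ) :
    ∑ y : ZMod p with y ≠ 0, ZMod.stdAddChar (y * (n : ZMod p)) =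
      (if (p : ℤ) ∣ n then (p : ℂ) else 0) - 1 := by
  have h := AddChar.sum_mulShift (n : ZMod p) (ZMod.isPrimitive_stdAddChar p)
  rw [← Finset.sum_filter_add_sum_filter_not _ (fun y : ZMod p => y ≠ 0)] at h
  simp only [ne_eq, not_not, Finset.filter_eq', Finset.mem_univ, if_true, Finset.sum_singleton,
    zero_mul, AddChar.map_zero_eq_one, ZMod.card, ZMod.intCast_zmod_eq_zero_iff_dvd] at h
  rw [eq_sub_iff_add_eq]
  exact h.trans (by split_ifs <;> simp)

theorem ramanujanSum_eq_sum_fibers {p : ℕ} (hp : p.Prime) (j : ℕ) (n : ℤ) :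
    ramanujanSum (p ^ (j + 1)) n =
      ∑ x ∈ (Finset.range p).filter (fun x => ¬ p ∣ x),
        e (((n * x : ℤ) : ℝ) / (p ^ (j + 1) : ℕ)) *
          if ((p ^ j : ℕ) : ℤ) ∣ n then ((p ^ j : ℕ) : ℂ) else 0 := by
  rw [ramanujanSum, sum_coprime_eq_sum_fibers hp]
  simp only [mul_comm _ n, sum_fiber_e hp]

theorem e_pow_mul_div {p : ℕ} [NeZero p] (j : ℕ) (m x : ℤ) :
    e (((((p ^ j : ℕ) : ℤ) * m * x : ℤ) : ℝ) / (p ^ (j + 1) : ℕ)) =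
      ZMod.stdAddChar ((x : ZMod p) * (m : ZMod p)) := by
  rw [← Int.cast_mul, ← e_intCast_div]
  congr 1
  have : (p : ℝ) ≠ 0 := mod_cast NeZero.ne p
  push_cast
  field_simp
  ring

theorem ramanujanSum_pow_mul {p : ℕ} (hp : p.Prime) (j : ℕ) (m : ℤ) :
    ramanujanSum (p ^ (j + 1)) ((p ^ j : ℕ) * m) =
      ((p ^ j : ℕ) : ℂ) * ((if (p : ℤ) ∣ m then (p : ℂ) else 0) - 1) := by
  have : NeZero p := ⟨hp.ne_zero⟩
  rw [ramanujanSum_eq_sum_fibers hp, ← sum_stdAddChar_ne_zero, ← Finset.sum_mul, mul_comm,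
    if_pos (dvd_mul_right _ _), ← sum_filter_not_dvd]
  congr 1
  refine Finset.sum_congr rfl fun x _ => ?_
  rw [e_pow_mul_div, Int.cast_natCast]

theorem ramanujanSum_of_not_dvd {p : ℕ} (hp : p.Prime) (j : ℕ) {n : ℤ}
    (h : ¬ ((p ^ j : ℕ) : ℤ) ∣ n) : ramanujanSum (p ^ (j + 1)) n = 0 := by
  rw [ramanujanSum_eq_sum_fibers hp]
  simp only [h, if_false, mul_zero, Finset.sum_const_zero]

theorem ramanujanSum_prime_pow_neg {p : ℕ} (hp : p.Prime) (j : ℕ) (n : ℤ) :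
    ramanujanSum (p ^ (j + 1)) (-n) = ramanujanSum (p ^ (j + 1)) n := by
  by_cases h : ((p ^ j : ℕ) : ℤ) ∣ n
  · obtain ⟨m, rfl⟩ := h
    rw [← mul_neg, ramanujanSum_pow_mul hp, ramanujanSum_pow_mul hp]
    simp only [dvd_neg]
  · rw [ramanujanSum_of_not_dvd hp j h, ramanujanSum_of_not_dvd hp j (by rwa [dvd_neg])]

/-- The solutions of `B x = B' x'` in `(ZMod p)²` form a line parametrised by
`y ↦ (B' y, B y)`. -/
theorem sum_line {p : ℕ} [Fact p.Prime] {B B' : ZMod p} (hB : B ≠ 0) (hB' : B' ≠ 0)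
    (f : ZMod p → ZMod p → ℂ) :
    ∑ x : ZMod p with x ≠ 0, ∑ x' : ZMod p with x' ≠ 0,
      (if B * x - B' * x' = 0 then f x x' else 0) =
      ∑ y : ZMod p with y ≠ 0, f (B' * y) (B * y) := by
  rw [← Finset.sum_product', ← Finset.sum_filter]
  refine Finset.sum_nbij' (fun z => B'⁻¹ * z.1) (fun y => (B' * y, B * y)) ?_ ?_ ?_ ?_ ?_
  · rintro ⟨x, x'⟩ h
    simp_all
  · intro y h
    simp_all
    ring
  · rintro ⟨x, x'⟩ h
    simp only [Finset.mem_filter, sub_eq_zero] at h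
    ext
    · simp [hB']
    · rw [← mul_right_inj' hB', ← h.2]
      field_simp
  · intro y _
    simp [hB']
  · rintro ⟨x, x'⟩ h
    simp only [Finset.mem_filter, sub_eq_zero] at h
    congr 1
    · simp [hB']
    · rw [← mul_right_inj' hB', ← h.2]
      field_simp

theorem Ssum_eq_sum_fibers {p : ℕ} (hp : p.Prime) (j : ℕ) (a a' B B' : ℤ) :
    Ssum (p ^ (j + 1)) a a' ((p ^ j : ℕ) * B) ((p ^ j : ℕ) * B') =
      ∑ x ∈ (Finset.range p).filter (fun x => ¬ p ∣ x),
        ∑ x' ∈ (Finset.range p).filter (fun x' => ¬ p ∣ x'),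
          (e (((a * x : ℤ) : ℝ) / (p ^ (j + 1) : ℕ)) *
            if ((p ^ j : ℕ) : ℤ) ∣ a then ((p ^ j : ℕ) : ℂ) else 0) *
          (e (((-a' * x' : ℤ) : ℝ) / (p ^ (j + 1) : ℕ)) *
            if ((p ^ j : ℕ) : ℤ) ∣ -a' then ((p ^ j : ℕ) : ℂ) else 0) *
          (((p ^ j : ℕ) : ℂ) * ((if (p : ℤ) ∣ B * x - B' * x' then (p : ℂ) else 0) - 1)) := by
  simp only [Ssum, sum_coprime_eq_sum_fibers hp]
  refine Finset.sum_congr rfl fun x _ => ?_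
  rw [Finset.sum_comm]
  refine Finset.sum_congr rfl fun x' _ => ?_
  rw [← sum_fiber_e hp, ← sum_fiber_e hp, Finset.sum_mul_sum, Finset.sum_mul]
  refine Finset.sum_congr rfl fun u _ => ?_
  rw [Finset.sum_mul]
  refine Finset.sum_congr rfl fun v _ => ?_
  have harg (y y' : ℤ) : ((p ^ j : ℕ) : ℤ) * B * y - (p ^ j : ℕ) * B' * y' =
      (p ^ j : ℕ) * (B * y - B' * y') := by ring
  rw [← e_add, harg, ramanujanSum_pow_mul hp]
  have h : (p : ℤ) ∣ B * (x + p * u : ℕ) - B' * (x' + p * v : ℕ) ↔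
      (p : ℤ) ∣ B * x - B' * x' := by
    rw [← dvd_sub_right (Dvd.intro (B * u - B' * v) rfl), iff_comm, ← dvd_neg]
    congr! 1
    push_cast
    ring
  simp only [h]
  congr 2
  push_cast
  ring

theorem sum_e_on_line {p : ℕ} (hp : p.Prime) (j : ℕ) (A A' : ℤ) {B B' : ℤ}
    (hB : ¬ (p : ℤ) ∣ B) (hB' : ¬ (p : ℤ) ∣ B') :
    ∑ x ∈ (Finset.range p).filter (fun x => ¬ p ∣ x),
      ∑ x' ∈ (Finset.range p).filter (fun x' => ¬ p ∣ x'),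
        (if (p : ℤ) ∣ B * x - B' * x' then
          e (((((p ^ j : ℕ) : ℤ) * A * x : ℤ) : ℝ) / (p ^ (j + 1) : ℕ)) *
            e (((((p ^ j : ℕ) : ℤ) * A' * x' : ℤ) : ℝ) / (p ^ (j + 1) : ℕ)) else 0) =
      (if (p : ℤ) ∣ A * B' + A' * B then (p : ℂ) else 0) - 1 := by
  have : Fact p.Prime := ⟨hp⟩
  simp only [← ZMod.intCast_zmod_eq_zero_iff_dvd, ← ne_eq] at hB hB'
  rw [← sum_stdAddChar_ne_zero]
  let f (x x' : ZMod p) : ℂ :=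
    ZMod.stdAddChar (x * (A : ZMod p)) * ZMod.stdAddChar (x' * (A' : ZMod p))
  let g (x x' : ZMod p) : ℂ := if B * x - B' * x' = 0 then f x x' else 0
  trans ∑ x ∈ (Finset.range p).filter (fun x => ¬ p ∣ x),
    ∑ x' ∈ (Finset.range p).filter (fun x' => ¬ p ∣ x'), g x x'
  · simp only [e_pow_mul_div]
    simp only [← ZMod.intCast_zmod_eq_zero_iff_dvd, Int.cast_sub, Int.cast_mul,
      Int.cast_natCast, g, f]
  simp only [sum_filter_not_dvd p (g _)]
  rw [sum_filter_not_dvd p (fun x => ∑ x' : ZMod p with x' ≠ 0, g x x'), sum_line hB hB' f]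
  refine Finset.sum_congr rfl fun y _ => ?_
  simp only [f]
  rw [← AddChar.map_add_eq_mul]
  congr 1
  push_cast
  ring

theorem Ssum_prime_pow_s7 {p : ℕ} (hp : p.Prime) (j : ℕ) (a a' : ℤ) {B B' : ℤ}
    (hB : ¬ (p : ℤ) ∣ B) (hB' : ¬ (p : ℤ) ∣ B') :
    Ssum (p ^ (j + 1)) a a' ((p ^ j : ℕ) * B) ((p ^ j : ℕ) * B') =
      (if ((p ^ j : ℕ) : ℤ) ∣ a ∧ ((p ^ j : ℕ) : ℤ) ∣ a' then
        ((p ^ (j + 1) : ℕ) : ℂ) * ramanujanSum (p ^ (j + 1) * p ^ j)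
          (a * ((p ^ j : ℕ) * B') - a' * ((p ^ j : ℕ) * B)) else 0) -
      ((p ^ j : ℕ) : ℂ) * ramanujanSum (p ^ (j + 1)) a * ramanujanSum (p ^ (j + 1)) a' := by
  rw [Ssum_eq_sum_fibers hp, ← ramanujanSum_prime_pow_neg hp j a',
    ramanujanSum_eq_sum_fibers hp j a, ramanujanSum_eq_sum_fibers hp j (-a'), mul_assoc,
    Finset.sum_mul_sum]
  simp only [mul_sub, Finset.sum_sub_distrib, mul_one]
  congr 1
  · by_cases h : ((p ^ j : ℕ) : ℤ) ∣ a ∧ ((p ^ j : ℕ) : ℤ) ∣ a'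
    · rw [if_pos h]
      obtain ⟨⟨A, rfl⟩, ⟨A', rfl⟩⟩ := h
      have hpow : p ^ (j + 1) * p ^ j = p ^ (2 * j + 1) := by ring
      have harg : ((p ^ j : ℕ) : ℤ) * A * ((p ^ j : ℕ) * B') -
          (p ^ j : ℕ) * A' * ((p ^ j : ℕ) * B) = (p ^ (2 * j) : ℕ) * (A * B' + -A' * B) := by
        push_cast
        ring
      rw [hpow, harg, ramanujanSum_pow_mul hp, ← sum_e_on_line hp j A (-A') hB hB']
      simp only [Finset.mul_sum, ← mul_neg, dvd_mul_right, if_true]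
      refine Finset.sum_congr rfl fun x _ => Finset.sum_congr rfl fun x' _ => ?_
      split_ifs
      · push_cast
        ring
      · ring
    · rw [if_neg h]
      rw [← dvd_neg (b := a'), not_and_or] at h
      rcases h with h | h <;> simp only [h, if_false, mul_zero, zero_mul, Finset.sum_const_zero]
  · simp only [Finset.mul_sum]
    refine Finset.sum_congr rfl fun x _ => Finset.sum_congr rfl fun x' _ => ?_
    ring

/-- For `q = p^k` a prime power, with `𝓑 = gcd(q,b,b′)`, `Q = q/𝓑`,
`B = b/𝓑`, `B′ = b′/𝓑`: if `p ∤ BB′` and `Q = p` then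
`𝒮 = q · c_{q𝓑}(ab′ − a′b) · 𝟙[(q/p) ∣ a ∧ (q/p) ∣ a′] − 𝓑 · c_q(a) · c_q(a′)`. -/
theorem stmt7 (p : ℕ) (hp : p.Prime) (k : ℕ) (q : ℕ) (hq : q = p ^ k)
    (a a' b b' : ℤ)
    (𝓑 : ℕ) (h𝓑 : 𝓑 = Nat.gcd q (Int.gcd b b'))
    (Q : ℕ) (hQ : Q = q / 𝓑)
    (B B' : ℤ) (hB : B = b / 𝓑) (hB' : B' = b' / 𝓑)
    (hndvd : ¬ (p : ℤ) ∣ B * B') (hQp : Q = p) :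
    Ssum q a a' b b' =
      (if ((q / p : ℕ) : ℤ) ∣ a ∧ ((q / p : ℕ) : ℤ) ∣ a'
        then (q : ℂ) * ramanujanSum (q * 𝓑) (a * b' - a' * b) else 0)
      - (𝓑 : ℂ) * ramanujanSum q a * ramanujanSum q a' := by
  have hB0 : ¬ (p : ℤ) ∣ B := fun h => hndvd (h.mul_right _)
  have hB0' : ¬ (p : ℤ) ∣ B' := fun h => hndvd (h.mul_left _)
  have hdq : 𝓑 ∣ q := h𝓑 ▸ Nat.gcd_dvd_left _ _
  have hdg : (𝓑 : ℤ) ∣ Int.gcd b b' := mod_cast h𝓑 ▸ Nat.gcd_dvd_right _ _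
  have hb : b = 𝓑 * B := by
    rw [hB, Int.mul_ediv_cancel' (hdg.trans (Int.gcd_dvd_left _ _))]
  have hb' : b' = 𝓑 * B' := by
    rw [hB', Int.mul_ediv_cancel' (hdg.trans (Int.gcd_dvd_right _ _))]
  have hqp : q = p * 𝓑 := by rw [← hQp, hQ, Nat.div_mul_cancel hdq]
  obtain _ | j := k
  · exact absurd (Dvd.intro _ (hqp.symm.trans hq)) (by simpa using hp.one_lt.ne')
  have hM : 𝓑 = p ^ j := by
    rw [hq, pow_succ'] at hqp
    exact (Nat.eq_of_mul_eq_mul_left hp.pos hqp).symm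
  have hdiv : q / p = p ^ j := by rw [hqp, Nat.mul_div_cancel_left _ hp.pos, hM]
  rw [hdiv, hb, hb', hM, hq, Ssum_prime_pow_s7 hp j a a' hB0 hB0']
end
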